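/- arXiv:2004.01784 — 3 statements merged into one kernel-verified Lean document; each statement's English description precedes it below -/
import Mathlib

section
/- There exists a constant C > 0 (depending only on the dimension d) such that the following holds. Let μ be a finite complex measure on ℝ^d and let f(x) = ∫_{ℝ^d} e^{2πi x·η} dμ(η) be its (inverse) Fourier transform, a bounded continuous function on ℝ^d. Then ∫_{ℝ^d} sup_{x ∈ ℝ^d} |V_g f(x,ξ)| dξ ≤ C |μ|(ℝ^d), where |μ| denotes the total variation measure. (That is, the Fourier transform of a finite complex measure belongs to the Sjöstrand class M^{∞,1}(ℝ^d), with norm controlled by the total variation of the measure.) -/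
open MeasureTheory Real Filter
open scoped RealInnerProductSpace ENNReal NNReal

noncomputable section

/-- The Gaussian window `g(t) = e^{-π|t|²}`. -/
def gaussWindow {d : ℕ} (t : EuclideanSpace ℝ (Fin d)) : ℂ :=
  (Real.exp (-π * ‖t‖ ^ 2) : ℝ)

/-- The short-time Fourier transform with Gaussian window:
`V_g f(x,ξ) = ∫ e^{-2πi ξ·t} f(t) g(t-x) dt`. -/
def STFT {d : ℕ} (f : EuclideanSpace ℝ (Fin d) → ℂ)
    (x ξ : EuclideanSpace ℝ (Fin d)) : ℂ :=
  ∫ (t : EuclideanSpace ℝ (Fin d)),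
    Complex.exp (-(((2 * π * ⟪ξ, t⟫ : ℝ) : ℂ) * Complex.I)) * f t * gaussWindow (t - x)

theorem enorm_integral_exp_mul_gaussWindow {d : ℕ} (x w : EuclideanSpace ℝ (Fin d)) :
    ‖∫ t, Complex.exp (-(((2 * π * ⟪w, t⟫ : ℝ) : ℂ) * Complex.I)) * gaussWindow (t - x)‖ₑ =
      ENNReal.ofReal (Real.exp (-π * ‖w‖ ^ 2)) := by
  have key : ∀ t : EuclideanSpace ℝ (Fin d),
      Complex.exp (-(((2 * π * ⟪w, t + x⟫ : ℝ) : ℂ) * Complex.I)) * gaussWindow (t + x - x) =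
        Complex.exp (((-(2 * π * ⟪w, x⟫) : ℝ) : ℂ) * Complex.I) *
          Complex.exp (-(π : ℂ) * ‖t‖ ^ 2 + (-(2 * π * Complex.I)) * ⟪w, t⟫) := by
    intro t
    rw [gaussWindow, add_sub_cancel_right, inner_add_right, Complex.ofReal_exp,
      ← Complex.exp_add, ← Complex.exp_add]
    congr 1
    push_cast
    ring
  rw [← integral_add_right_eq_self _ x]
  simp_rw [key]
  rw [integral_const_mul, GaussianFourier.integral_cexp_neg_mul_sq_norm_add
      (by simpa using Real.pi_pos), ← ofReal_norm, norm_mul, norm_mul,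
    Complex.norm_exp_ofReal_mul_I, div_self (by exact_mod_cast Real.pi_ne_zero),
    Complex.one_cpow, norm_one, one_mul, one_mul]
  have : (-(2 * (π : ℂ) * Complex.I)) ^ 2 * (‖w‖ : ℂ) ^ 2 / (4 * π) =
      ((-π * ‖w‖ ^ 2 : ℝ) : ℂ) := by
    have : (π : ℂ) ≠ 0 := by exact_mod_cast Real.pi_ne_zero
    field_simp
    push_cast
    rw [Complex.I_sq]
    ring
  rw [this, ← Complex.ofReal_exp, Complex.norm_real, Real.norm_of_nonneg (Real.exp_pos _).le]

theorem integrable_exp_neg_pi_mul_norm_sq {d : ℕ} :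
    Integrable fun t : EuclideanSpace ℝ (Fin d) => Real.exp (-π * ‖t‖ ^ 2) := by
  have h := GaussianFourier.integrable_cexp_neg_mul_sq_norm_add
    (V := EuclideanSpace ℝ (Fin d)) (b := (π : ℂ)) (by simpa using Real.pi_pos) 0 0
  refine h.norm.congr (ae_of_all _ fun t => ?_)
  simp [Complex.norm_exp, ← Complex.ofReal_pow]

theorem lintegral_exp_neg_pi_mul_norm_sq {d : ℕ} :
    ∫⁻ t : EuclideanSpace ℝ (Fin d), ENNReal.ofReal (Real.exp (-π * ‖t‖ ^ 2)) = 1 := by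
  rw [← ofReal_integral_eq_lintegral_ofReal integrable_exp_neg_pi_mul_norm_sq
    (ae_of_all _ fun t => (Real.exp_pos _).le)]
  have h := GaussianFourier.integral_rexp_neg_mul_sq_norm
    (V := EuclideanSpace ℝ (Fin d)) Real.pi_pos
  rw [h, div_self Real.pi_ne_zero, Real.one_rpow, ENNReal.ofReal_one]

theorem continuous_gaussWindow {d : ℕ} :
    Continuous (gaussWindow : EuclideanSpace ℝ (Fin d) → ℂ) := by
  unfold gaussWindow
  fun_prop

theorem integrable_gaussWindow {d : ℕ} :
    Integrable (gaussWindow : EuclideanSpace ℝ (Fin d) → ℂ) :=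
  integrable_exp_neg_pi_mul_norm_sq.ofReal

/-- The STFT of the inverse Fourier transform of `h dν`, as a superposition over frequencies. -/
theorem STFT_integral_exp {d : ℕ} (ν : Measure (EuclideanSpace ℝ (Fin d))) [IsFiniteMeasure ν]
    {h : EuclideanSpace ℝ (Fin d) → ℂ} (hm : Measurable h) (h1 : ∀ η, ‖h η‖ = 1)
    (x ξ : EuclideanSpace ℝ (Fin d)) :
    STFT (fun x => ∫ η, Complex.exp ((((2 * π * ⟪x, η⟫ : ℝ) : ℂ) * Complex.I)) * h η ∂ν) x ξ =
      ∫ η, h η * (∫ t, Complex.exp (-(((2 * π * ⟪ξ - η, t⟫ : ℝ) : ℂ) * Complex.I)) *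
        gaussWindow (t - x)) ∂ν := by
  have hint : Integrable (Function.uncurry fun t η : EuclideanSpace ℝ (Fin d) =>
      h η * (Complex.exp (-(((2 * π * ⟪ξ - η, t⟫ : ℝ) : ℂ) * Complex.I)) *
        gaussWindow (t - x))) (volume.prod ν) := by
    have hg : Integrable (fun p : EuclideanSpace ℝ (Fin d) × EuclideanSpace ℝ (Fin d) =>
        gaussWindow (p.1 - x)) (volume.prod ν) :=
      (integrable_gaussWindow.comp_sub_right x).comp_fst ν
    refine hg.mono ?_ (ae_of_all _ fun p => ?_)
    · have hc : Continuous fun p : EuclideanSpace ℝ (Fin d) × EuclideanSpace ℝ (Fin d) =>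
          Complex.exp (-(((2 * π * ⟪ξ - p.2, p.1⟫ : ℝ) : ℂ) * Complex.I)) *
            gaussWindow (p.1 - x) := by
        have := continuous_gaussWindow (d := d)
        fun_prop
      exact ((hm.comp measurable_snd).mul hc.measurable).aestronglyMeasurable
    · simp only [Function.uncurry, norm_mul, h1, one_mul]
      rw [← neg_mul, ← Complex.ofReal_neg, Complex.norm_exp_ofReal_mul_I, one_mul]
  simp_rw [← integral_const_mul]
  rw [← integral_integral_swap hint, STFT]
  refine integral_congr_ae (ae_of_all _ fun t => ?_)
  simp only
  rw [← integral_const_mul, ← integral_mul_const]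
  refine integral_congr_ae (ae_of_all _ fun η => ?_)
  have he : Complex.exp (-(((2 * π * ⟪ξ - η, t⟫ : ℝ) : ℂ) * Complex.I)) =
      Complex.exp (-(((2 * π * ⟪ξ, t⟫ : ℝ) : ℂ) * Complex.I)) *
        Complex.exp (((2 * π * ⟪t, η⟫ : ℝ) : ℂ) * Complex.I) := by
    rw [← Complex.exp_add, inner_sub_left, real_inner_comm t η]
    congr 1
    push_cast
    ring
  simp only
  rw [he]
  ring

/-- **The Fourier transform of a finite complex measure lies in the Sjöstrand class**
`M^{∞,1}(ℝ^d)`, with norm controlled by the total variation of the measure. A finite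
complex measure is represented by its polar decomposition `dμ = h dν`, where `ν = |μ|`
is a finite positive measure (the total variation) and `h` is a measurable unimodular
density; `f(x) = ∫ e^{2πi x·η} dμ(η) = ∫ e^{2πi x·η} h(η) dν(η)`, and
`‖f‖_{M^{∞,1}} = ∫ sup_x |V_g f(x,ξ)| dξ ≤ C·|μ|(ℝ^d) = C·ν(ℝ^d)`. -/
theorem fourier_of_measure_mem_sjostrand
    {d : ℕ} (hd : 1 ≤ d) :
    ∃ C : ℝ, 0 < C ∧
      ∀ (ν : Measure (EuclideanSpace ℝ (Fin d))), IsFiniteMeasure ν →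
        ∀ h : EuclideanSpace ℝ (Fin d) → ℂ, Measurable h → (∀ η, ‖h η‖ = 1) →
          (∫⁻ ξ : EuclideanSpace ℝ (Fin d),
              ⨆ x : EuclideanSpace ℝ (Fin d),
                (‖STFT (fun x => ∫ η, Complex.exp ((((2 * π * ⟪x, η⟫ : ℝ) : ℂ) * Complex.I)) *
                    h η ∂ν) x ξ‖₊ : ℝ≥0∞)) ≤
            ENNReal.ofReal C * ν Set.univ := by
  refine ⟨1, one_pos, fun ν hν h hm h1 => ?_⟩
  calc
    _ ≤ ∫⁻ ξ : EuclideanSpace ℝ (Fin d), ∫⁻ η, ENNReal.ofReal (Real.exp (-π * ‖ξ - η‖ ^ 2)) ∂ν := by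
      refine lintegral_mono fun ξ => iSup_le fun x => ?_
      rw [STFT_integral_exp ν hm h1]
      refine (enorm_integral_le_lintegral_enorm _).trans (lintegral_mono fun η => ?_)
      rw [enorm_mul, enorm_integral_exp_mul_gaussWindow, ← ofReal_norm, h1,
        ENNReal.ofReal_one, one_mul]
    _ = ∫⁻ η, ∫⁻ ξ : EuclideanSpace ℝ (Fin d),
          ENNReal.ofReal (Real.exp (-π * ‖ξ - η‖ ^ 2)) ∂volume ∂ν :=
      lintegral_lintegral_swap (by fun_prop)
    _ = ENNReal.ofReal 1 * ν Set.univ := by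
      have hi : ∀ η : EuclideanSpace ℝ (Fin d), ∫⁻ ξ : EuclideanSpace ℝ (Fin d),
          ENNReal.ofReal (Real.exp (-π * ‖ξ - η‖ ^ 2)) = 1 := fun η => by
        rw [lintegral_sub_right_eq_self
          (fun ξ : EuclideanSpace ℝ (Fin d) => ENNReal.ofReal (Real.exp (-π * ‖ξ‖ ^ 2))),
          lintegral_exp_neg_pi_mul_norm_sq]
      simp_rw [hi]
      simp
end
end

section
/- Let f ∈ 𝓢'(ℝ^d) be a tempered distribution. The following are equivalent: (i) for every s > 0, sup_{(x,ξ) ∈ ℝ^{2d}} ⟨ξ⟩^s |V_g f(x,ξ)| < ∞; (ii) there is a smooth function h : ℝ^d → ℂ such that for every multi-index α the derivative ∂^α h is bounded on ℝ^d, and f equals h as a tempered distribution. (That is, ⋂_{s>0} M^∞_s(ℝ^d) = C^∞_b(ℝ^d).) -/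
open MeasureTheory Real Filter
open scoped RealInnerProductSpace ENNReal

noncomputable section

open scoped SchwartzMap ContDiff Topology BoundedContinuousFunction

section WeightedIteratedFDeriv

/-- Bounded continuous functions on `E` with values in the `n`-linear forms. -/
def BoundedFormField (E : Type*) [NormedAddCommGroup E] [NormedSpace ℝ E] (n : ℕ) : Type _ :=
  E →ᵇ (E [×n]→L[ℝ] ℂ)

namespace BoundedFormField

variable {E : Type*} [NormedAddCommGroup E] [NormedSpace ℝ E] {n : ℕ}

instance : NormedAddCommGroup (BoundedFormField E n) :=
  inferInstanceAs (NormedAddCommGroup (E →ᵇ (E [×n]→L[ℝ] ℂ)))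

instance : NormedSpace ℂ (BoundedFormField E n) :=
  inferInstanceAs (NormedSpace ℂ (E →ᵇ (E [×n]→L[ℝ] ℂ)))

instance : CompleteSpace (BoundedFormField E n) :=
  inferInstanceAs (CompleteSpace (E →ᵇ (E [×n]→L[ℝ] ℂ)))

/-- Evaluation at a point. -/
def evalCLM (x : E) : BoundedFormField E n →L[ℂ] (E [×n]→L[ℝ] ℂ) :=
  BoundedContinuousFunction.evalCLM ℂ x

lemma ext {F G : BoundedFormField E n} (h : ∀ x, evalCLM x F = evalCLM x G) : F = G :=
  BoundedContinuousFunction.ext h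

lemma norm_evalCLM_le (F : BoundedFormField E n) (x : E) : ‖evalCLM x F‖ ≤ ‖F‖ :=
  BoundedContinuousFunction.norm_coe_le_norm F x

/-- A bounded continuous form field from a pointwise bound. -/
def ofBound (F : E → (E [×n]→L[ℝ] ℂ)) (hF : Continuous F) (C : ℝ) (hC : ∀ x, ‖F x‖ ≤ C) :
    BoundedFormField E n :=
  BoundedContinuousFunction.ofNormedAddCommGroup F hF C hC

lemma norm_ofBound_le (F : E → (E [×n]→L[ℝ] ℂ)) (hF : Continuous F) {C : ℝ} (h0 : 0 ≤ C)
    (hC : ∀ x, ‖F x‖ ≤ C) : ‖ofBound F hF C hC‖ ≤ C :=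
  BoundedContinuousFunction.norm_ofNormedAddCommGroup_le hF h0 hC

end BoundedFormField

/-- The map `φ ↦ (x ↦ ‖x‖ ^ k • D^n φ x)` from Schwartz functions to bounded form fields. -/
def weightedIteratedFDeriv (E : Type*) [NormedAddCommGroup E] [NormedSpace ℝ E] (i : ℕ × ℕ) :
    𝓢(E, ℂ) →L[ℂ] BoundedFormField E i.2 :=
  SchwartzMap.mkCLMtoNormedSpace (𝕜 := ℂ) (𝕜' := ℂ)
    (fun φ : 𝓢(E, ℂ) ↦ BoundedFormField.ofBound
      (fun x ↦ ‖x‖ ^ i.1 • iteratedFDeriv ℝ i.2 φ x)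
      ((continuous_norm.pow _).smul
        ((φ.smooth ⊤).continuous_iteratedFDeriv (mod_cast le_top)))
      (SchwartzMap.seminorm ℂ i.1 i.2 φ)
      (fun x ↦ by
        rw [norm_smul, norm_pow, norm_norm]
        exact SchwartzMap.le_seminorm ℂ i.1 i.2 φ x))
    (fun φ ψ ↦ by
      refine BoundedFormField.ext fun x ↦ ?_
      refine Eq.trans ?_ ((BoundedFormField.evalCLM x).map_add _ _).symm
      change ‖x‖ ^ i.1 • iteratedFDeriv ℝ i.2 (⇑φ + ⇑ψ) x = ‖x‖ ^ i.1 • iteratedFDeriv ℝ i.2 φ x +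
        ‖x‖ ^ i.1 • iteratedFDeriv ℝ i.2 ψ x
      rw [iteratedFDeriv_add_apply ((φ.smooth i.2).contDiffAt) ((ψ.smooth i.2).contDiffAt),
        smul_add])
    (fun a φ ↦ by
      refine BoundedFormField.ext fun x ↦ ?_
      refine Eq.trans ?_ ((BoundedFormField.evalCLM x).map_smul a _).symm
      change ‖x‖ ^ i.1 • iteratedFDeriv ℝ i.2 (a • ⇑φ) x =
        a • ‖x‖ ^ i.1 • iteratedFDeriv ℝ i.2 φ x
      rw [iteratedFDeriv_const_smul_apply ((φ.smooth i.2).contDiffAt), smul_comm])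
    ⟨{i}, 1, zero_le_one, fun φ ↦ by
      rw [one_mul, Finset.sup_singleton]
      exact BoundedFormField.norm_ofBound_le _ _ (apply_nonneg _ _) _⟩

variable {E : Type*} [NormedAddCommGroup E] [NormedSpace ℝ E]

open BoundedFormField (evalCLM)

lemma weightedIteratedFDeriv_apply (i : ℕ × ℕ) (φ : 𝓢(E, ℂ)) (x : E) :
    evalCLM x (weightedIteratedFDeriv E i φ) = ‖x‖ ^ i.1 • iteratedFDeriv ℝ i.2 φ x := rfl

lemma norm_weightedIteratedFDeriv_le (i : ℕ × ℕ) (φ : 𝓢(E, ℂ)) :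
    ‖weightedIteratedFDeriv E i φ‖ ≤ SchwartzMap.seminorm ℂ i.1 i.2 φ := by
  refine BoundedFormField.norm_ofBound_le _ _ (apply_nonneg _ _) fun x ↦ ?_
  rw [norm_smul, norm_pow, norm_norm]
  exact SchwartzMap.le_seminorm ℂ i.1 i.2 φ x

lemma seminorm_le_norm_weightedIteratedFDeriv (i : ℕ × ℕ) (φ : 𝓢(E, ℂ)) :
    SchwartzMap.seminorm ℂ i.1 i.2 φ ≤ ‖weightedIteratedFDeriv E i φ‖ := by
  refine SchwartzMap.seminorm_le_bound ℂ _ _ _ (norm_nonneg _) fun x ↦ ?_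
  have := BoundedFormField.norm_evalCLM_le (weightedIteratedFDeriv E i φ) x
  rwa [weightedIteratedFDeriv_apply, norm_smul, norm_pow, norm_norm] at this

/-- A tempered distribution factors through finitely many weighted derivatives. -/
lemma exists_eq_comp_weightedIteratedFDeriv (f : 𝓢(E, ℂ) →L[ℂ] ℂ) :
    ∃ (s : Finset (ℕ × ℕ)) (L : (∀ i : s, BoundedFormField E i.1.2) →L[ℂ] ℂ),
      ∀ φ, f φ = L fun i ↦ weightedIteratedFDeriv E i φ := by
  classical
  obtain ⟨s, C, -, hC⟩ := Seminorm.bound_of_continuous (schwartz_withSeminorms ℂ E ℂ)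
    ((normSeminorm ℂ ℂ).comp f.toLinearMap) (continuous_norm.comp f.continuous)
  set t := insert (0, 0) s with ht
  let J : 𝓢(E, ℂ) →L[ℂ] (∀ i : t, BoundedFormField E i.1.2) :=
    ContinuousLinearMap.pi fun i ↦ weightedIteratedFDeriv E i
  have hsem (φ : 𝓢(E, ℂ)) (i : ℕ × ℕ) (hi : i ∈ t) :
      SchwartzMap.seminorm ℂ i.1 i.2 φ ≤ ‖J φ‖ :=
    (seminorm_le_norm_weightedIteratedFDeriv i φ).trans (norm_le_pi_norm (J φ) ⟨i, hi⟩)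
  have hJ : Function.Injective J.toLinearMap := by
    refine (injective_iff_map_eq_zero J.toLinearMap).2 fun φ hφ ↦ ?_
    ext x
    have h1 := (SchwartzMap.norm_le_seminorm ℂ φ x).trans
      (hsem φ (0, 0) (Finset.mem_insert_self _ _))
    have h2 : J φ = 0 := hφ
    rw [h2, norm_zero] at h1
    simpa using h1
  let e := LinearEquiv.ofInjective J.toLinearMap hJ
  have he (φ : 𝓢(E, ℂ)) : ‖f φ‖ ≤ C * ‖J φ‖ := by
    refine (hC φ).trans ?_
    change (C : ℝ) * _ ≤ _
    gcongr
    refine Seminorm.finset_sup_apply_le (norm_nonneg _) fun i hi ↦ ?_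
    exact hsem φ i (Finset.mem_insert_of_mem hi)
  let f' : StrongDual ℂ (LinearMap.range J.toLinearMap) :=
    LinearMap.mkContinuous (f.toLinearMap.comp e.symm.toLinearMap) C (fun y ↦ by
      obtain ⟨φ, rfl⟩ := e.surjective y
      rw [LinearMap.comp_apply, LinearEquiv.coe_coe, e.symm_apply_apply]
      exact he φ)
  obtain ⟨L, hL, -⟩ := exists_extension_norm_eq (LinearMap.range J.toLinearMap) f'
  refine ⟨t, L, fun φ ↦ ?_⟩
  have := hL (e φ)
  have h3 : f' (e φ) = f φ := by simp [f']
  rw [h3] at this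
  exact this.symm

lemma continuous_schwartz_eval {F : Type*} [NormedAddCommGroup F] [NormedSpace ℝ F] (t : E) :
    Continuous fun φ : 𝓢(E, F) ↦ φ t :=
  (BoundedContinuousFunction.evalCLM ℝ t).continuous.comp
    (SchwartzMap.toBoundedContinuousFunctionCLM ℝ E F).continuous

variable {X : Type*} [TopologicalSpace X] [MeasurableSpace X] [OpensMeasurableSpace X]
  {μ : Measure X}

lemma integrable_seminorm_comp {Ψ : X → 𝓢(E, ℂ)} (hΨ : Continuous Ψ)
    (hint : ∀ k n, Integrable (fun ξ ↦ SchwartzMap.seminorm ℂ k n (Ψ ξ)) μ)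
    (A : 𝓢(E, ℂ) →L[ℂ] 𝓢(E, ℂ)) (k n : ℕ) :
    Integrable (fun ξ ↦ SchwartzMap.seminorm ℂ k n (A (Ψ ξ))) μ := by
  have hcont : Continuous fun φ : 𝓢(E, ℂ) ↦ SchwartzMap.seminorm ℂ k n (A φ) :=
    ((schwartz_withSeminorms ℂ E ℂ).continuous_seminorm (k, n)).comp A.continuous
  let p : Seminorm ℂ 𝓢(E, ℂ) :=
    (SchwartzMap.seminorm ℂ k n).comp (A : 𝓢(E, ℂ) →ₗ[ℂ] 𝓢(E, ℂ))
  obtain ⟨s, C, -, hC⟩ := Seminorm.bound_of_continuous (schwartz_withSeminorms ℂ E ℂ)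
    p hcont
  have hsum : Integrable (fun ξ ↦ (C : ℝ) * ∑ i ∈ s, SchwartzMap.seminorm ℂ i.1 i.2 (Ψ ξ)) μ :=
    (integrable_finsetSum s fun i _ ↦ hint i.1 i.2).const_mul _
  refine hsum.mono' (hcont.comp hΨ).aestronglyMeasurable (.of_forall fun ξ ↦ ?_)
  rw [Real.norm_of_nonneg (apply_nonneg _ _)]
  refine (hC (Ψ ξ)).trans ?_
  change (C : ℝ) * _ ≤ _
  gcongr
  refine Seminorm.finset_sup_apply_le (Finset.sum_nonneg fun _ _ ↦ apply_nonneg _ _)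
    fun i hi ↦ ?_
  exact Finset.single_le_sum (f := fun i : ℕ × ℕ ↦ SchwartzMap.seminorm ℂ i.1 i.2 (Ψ ξ))
    (fun _ _ ↦ apply_nonneg _ _) hi

variable [SecondCountableTopology X]

lemma integrable_weightedIteratedFDeriv {Ψ : X → 𝓢(E, ℂ)} (hΨ : Continuous Ψ)
    (hint : ∀ k n, Integrable (fun ξ ↦ SchwartzMap.seminorm ℂ k n (Ψ ξ)) μ) (i : ℕ × ℕ) :
    Integrable (fun ξ ↦ weightedIteratedFDeriv E i (Ψ ξ)) μ :=
  (hint i.1 i.2).mono' ((weightedIteratedFDeriv E i).continuous.comp hΨ).aestronglyMeasurable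
    (.of_forall fun _ ↦ norm_weightedIteratedFDeriv_le i _)

open LineDeriv in
lemma lineDerivOp_eq_integral {Ψ : X → 𝓢(E, ℂ)} (hΨ : Continuous Ψ)
    (hint : ∀ k n, Integrable (fun ξ ↦ SchwartzMap.seminorm ℂ k n (Ψ ξ)) μ)
    {Φ : 𝓢(E, ℂ)} (hΦ : ∀ t, Φ t = ∫ ξ, Ψ ξ t ∂μ) (v t : E) :
    ∂_{v} Φ t = ∫ ξ, ∂_{v} (Ψ ξ) t ∂μ := by
  have hev (t : E) : Continuous fun φ : 𝓢(E, ℂ) ↦ φ t := continuous_schwartz_eval t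
  have hev' (t : E) : Continuous fun φ : 𝓢(E, ℂ) ↦ fderiv ℝ φ t :=
    (continuous_schwartz_eval t).comp (SchwartzMap.fderivCLM ℝ E ℂ).continuous
  have hbd (ξ : X) (s : E) : ‖fderiv ℝ (Ψ ξ) s‖ ≤ SchwartzMap.seminorm ℂ 0 1 (Ψ ξ) := by
    rw [← norm_iteratedFDeriv_one]
    exact SchwartzMap.norm_iteratedFDeriv_le_seminorm ℂ _ 1 s
  have hI : Integrable (fun ξ ↦ fderiv ℝ (Ψ ξ) t) μ :=
    (hint 0 1).mono' ((hev' t).comp hΨ).aestronglyMeasurable (.of_forall fun ξ ↦ hbd ξ t)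
  have hd : HasFDerivAt (fun t ↦ ∫ ξ, Ψ ξ t ∂μ) (∫ ξ, fderiv ℝ (Ψ ξ) t ∂μ) t := by
    refine hasFDerivAt_integral_of_dominated_of_fderiv_le (s := Set.univ)
      (bound := fun ξ ↦ SchwartzMap.seminorm ℂ 0 1 (Ψ ξ))
      (F' := fun t ξ ↦ fderiv ℝ (Ψ ξ) t) univ_mem
      (.of_forall fun s ↦ ((hev s).comp hΨ).aestronglyMeasurable) ?_
      ((hev' t).comp hΨ).aestronglyMeasurable
      (.of_forall fun ξ s _ ↦ hbd ξ s) (hint 0 1)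
      (.of_forall fun ξ s _ ↦ (Ψ ξ).differentiableAt.hasFDerivAt)
    exact (hint 0 0).mono' ((hev t).comp hΨ).aestronglyMeasurable
      (.of_forall fun ξ ↦ SchwartzMap.norm_le_seminorm ℂ _ t)
  simp_rw [SchwartzMap.lineDerivOp_apply_eq_fderiv]
  rw [← ContinuousLinearMap.integral_apply hI, ← hd.fderiv]
  congr 2
  exact funext hΦ

open LineDeriv in
lemma iteratedFDeriv_eq_integral {Ψ : X → 𝓢(E, ℂ)} (hΨ : Continuous Ψ)
    (hint : ∀ k n, Integrable (fun ξ ↦ SchwartzMap.seminorm ℂ k n (Ψ ξ)) μ)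
    {Φ : 𝓢(E, ℂ)} (hΦ : ∀ t, Φ t = ∫ ξ, Ψ ξ t ∂μ) {n : ℕ} (m : Fin n → E) (t : E) :
    iteratedFDeriv ℝ n Φ t m = ∫ ξ, iteratedFDeriv ℝ n (Ψ ξ) t m ∂μ := by
  simp_rw [← SchwartzMap.iteratedLineDerivOp_eq_iteratedFDeriv]
  induction n generalizing t with
  | zero => simpa using hΦ t
  | succ n ih =>
    simp_rw [iteratedLineDerivOp_succ_left]
    refine lineDerivOp_eq_integral (Ψ := fun ξ ↦ ∂^{Fin.tail m} (Ψ ξ)) ?_ ?_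
      (fun t ↦ ih (Fin.tail m) t) (m 0) t
    · exact (continuous_iteratedLineDerivOp _).comp hΨ
    · exact integrable_seminorm_comp hΨ hint (iteratedLineDerivOpCLM ℂ 𝓢(E, ℂ) (Fin.tail m))

/-- A tempered distribution commutes with integrals of Schwartz-valued functions. -/
lemma map_eq_integral_of_forall_eq_integral (f : 𝓢(E, ℂ) →L[ℂ] ℂ) {Ψ : X → 𝓢(E, ℂ)}
    (hΨ : Continuous Ψ)
    (hint : ∀ k n, Integrable (fun ξ ↦ SchwartzMap.seminorm ℂ k n (Ψ ξ)) μ)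
    (Φ : 𝓢(E, ℂ)) (hΦ : ∀ t, Φ t = ∫ ξ, Ψ ξ t ∂μ) :
    f Φ = ∫ ξ, f (Ψ ξ) ∂μ := by
  obtain ⟨s, L, hL⟩ := exists_eq_comp_weightedIteratedFDeriv f
  have hJ : Integrable (fun ξ ↦ fun i : s ↦ weightedIteratedFDeriv E i.1 (Ψ ξ)) μ :=
    Integrable.of_eval fun i ↦ integrable_weightedIteratedFDeriv hΨ hint i
  simp_rw [hL]
  rw [L.integral_comp_comm hJ]
  congr 1
  funext i
  rw [eval_integral fun i ↦ integrable_weightedIteratedFDeriv hΨ hint _]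
  refine BoundedFormField.ext fun t ↦ ?_
  have h1 : evalCLM t (∫ ξ, weightedIteratedFDeriv E i.1 (Ψ ξ) ∂μ) =
      ∫ ξ, evalCLM t (weightedIteratedFDeriv E i.1 (Ψ ξ)) ∂μ :=
    ((evalCLM t).integral_comp_comm
      (integrable_weightedIteratedFDeriv hΨ hint i.1)).symm
  rw [h1]
  have h2 : Integrable (fun ξ ↦ evalCLM t (weightedIteratedFDeriv E i.1 (Ψ ξ))) μ :=
    (evalCLM t).integrable_comp (integrable_weightedIteratedFDeriv hΨ hint i.1)
  ext m
  rw [ContinuousMultilinearMap.integral_apply h2]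
  simp_rw [weightedIteratedFDeriv_apply, smul_apply]
  rw [integral_smul, iteratedFDeriv_eq_integral hΨ hint hΦ]

end WeightedIteratedFDeriv

section Multiplier

variable {E : Type*} [NormedAddCommGroup E] [NormedSpace ℝ E]

/-- Multiplication by a smooth function whose first `n` derivatives grow at most linearly
is controlled by the growth constant. -/
lemma exists_seminorm_mul_le (φ : 𝓢(E, ℂ)) (k n : ℕ) :
    ∃ M : ℝ, 0 ≤ M ∧ ∀ (u : E → ℂ) (A : ℝ) (ψ : 𝓢(E, ℂ)), ContDiff ℝ ∞ u → 0 ≤ A →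
      (∀ j ≤ n, ∀ t, ‖iteratedFDeriv ℝ j u t‖ ≤ A * (1 + ‖t‖)) → (∀ t, ψ t = u t * φ t) →
      SchwartzMap.seminorm ℂ k n ψ ≤ A * M := by
  refine ⟨∑ j ∈ Finset.range (n + 1), (n.choose j : ℝ) *
    (SchwartzMap.seminorm ℂ k (n - j) φ + SchwartzMap.seminorm ℂ (k + 1) (n - j) φ),
    by positivity, fun u A ψ hu hA hb hψ ↦ ?_⟩
  refine SchwartzMap.seminorm_le_bound ℂ _ _ _ (by positivity) fun t ↦ ?_
  have hψ' : (ψ : E → ℂ) = fun t ↦ u t * φ t := funext hψ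
  rw [hψ']
  have h1 := norm_iteratedFDeriv_mul_le hu (φ.smooth ⊤) t (n := n) (mod_cast le_top)
  calc ‖t‖ ^ k * ‖iteratedFDeriv ℝ n (fun t ↦ u t * φ t) t‖
      ≤ ‖t‖ ^ k * ∑ j ∈ Finset.range (n + 1), (n.choose j : ℝ) * ‖iteratedFDeriv ℝ j u t‖ *
          ‖iteratedFDeriv ℝ (n - j) φ t‖ := by gcongr
    _ ≤ A * _ := by
      rw [Finset.mul_sum, Finset.mul_sum]
      refine Finset.sum_le_sum fun j hj ↦ ?_
      have hj' : j ≤ n := by simpa [Nat.lt_succ_iff] using hj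
      calc ‖t‖ ^ k * ((n.choose j : ℝ) * ‖iteratedFDeriv ℝ j u t‖ *
            ‖iteratedFDeriv ℝ (n - j) φ t‖)
          ≤ ‖t‖ ^ k * ((n.choose j : ℝ) * (A * (1 + ‖t‖)) *
            ‖iteratedFDeriv ℝ (n - j) φ t‖) := by
            gcongr
            exact hb j hj' t
        _ = A * ((n.choose j : ℝ) * (‖t‖ ^ k * ‖iteratedFDeriv ℝ (n - j) φ t‖ +
            ‖t‖ ^ (k + 1) * ‖iteratedFDeriv ℝ (n - j) φ t‖)) := by ring
        _ ≤ _ := by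
            gcongr <;> exact SchwartzMap.le_seminorm ℂ _ _ φ t

end Multiplier

section Character

variable {E : Type*} [NormedAddCommGroup E] [InnerProductSpace ℝ E]

/-- The character `t ↦ e^{-2πiξ·t}`. -/
def stftCharacter (ξ t : E) : ℂ :=
  Complex.exp (-(((2 * π * ⟪ξ, t⟫ : ℝ) : ℂ) * Complex.I))

lemma contDiff_stftCharacter (ξ : E) : ContDiff ℝ ∞ (stftCharacter ξ) := by
  unfold stftCharacter
  refine ContDiff.cexp (ContDiff.neg (ContDiff.mul (Complex.ofRealCLM.contDiff.comp ?_)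
    contDiff_const))
  exact contDiff_const.mul (contDiff_const.inner ℝ contDiff_id)

lemma norm_stftCharacter (ξ t : E) : ‖stftCharacter ξ t‖ = 1 := by
  rw [stftCharacter, ← neg_mul, ← Complex.ofReal_neg, Complex.norm_exp_ofReal_mul_I]

lemma stftCharacter_add (ξ η t : E) :
    stftCharacter (ξ + η) t = stftCharacter ξ t * stftCharacter η t := by
  rw [stftCharacter, stftCharacter, stftCharacter, ← Complex.exp_add, inner_add_left]
  push_cast
  ring_nf

lemma iteratedDeriv_cexp_ofReal_const_mul (c : ℂ) (n : ℕ) :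
    iteratedDeriv n (fun s : ℝ ↦ Complex.exp (c * s)) = fun s : ℝ ↦ c ^ n * Complex.exp (c * s) := by
  induction n with
  | zero => simp
  | succ n ih =>
    rw [iteratedDeriv_succ, ih]
    funext s
    have h : HasDerivAt (fun s : ℝ ↦ Complex.exp (c * s)) (Complex.exp (c * s) * (c * 1)) s :=
      ((hasDerivAt_id s).ofReal_comp.const_mul c).cexp
    rw [(h.const_mul (c ^ n)).deriv]
    ring

lemma norm_iteratedFDeriv_stftCharacter_le (ξ t : E) (n : ℕ) :
    ‖iteratedFDeriv ℝ n (stftCharacter ξ) t‖ ≤ (2 * π * ‖ξ‖) ^ n := by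
  set c : ℂ := -((2 * π : ℝ) * Complex.I)
  have hc : ‖c‖ = 2 * π := by
    simp [c, abs_of_pos Real.pi_pos]
  have heq : stftCharacter ξ = (fun s : ℝ ↦ Complex.exp (c * s)) ∘ innerSL ℝ ξ := by
    funext t
    simp only [stftCharacter, c, Function.comp_apply, innerSL_apply_apply]
    push_cast
    ring_nf
  have hsm : ContDiff ℝ n fun s : ℝ ↦ Complex.exp (c * s) :=
    (contDiff_const.mul Complex.ofRealCLM.contDiff).cexp
  rw [heq, (innerSL ℝ ξ).iteratedFDeriv_comp_right hsm t le_rfl]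
  refine (ContinuousMultilinearMap.norm_compContinuousLinearMap_le _ _).trans ?_
  rw [norm_iteratedFDeriv_eq_norm_iteratedDeriv, iteratedDeriv_cexp_ofReal_const_mul, norm_mul,
    norm_pow, hc, Finset.prod_const, Finset.card_univ, Fintype.card_fin, innerSL_apply_norm]
  have : ‖Complex.exp (c * (innerSL ℝ ξ t : ℝ))‖ = 1 := by
    have := norm_stftCharacter ξ t
    rwa [heq] at this
  rw [this, mul_one, ← mul_pow]

lemma norm_stftCharacter_sub_one_le (η t : E) :
    ‖stftCharacter η t - 1‖ ≤ 2 * π * ‖η‖ * ‖t‖ := by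
  have h := Real.norm_exp_I_mul_ofReal_sub_one_le (x := -(2 * π * ⟪η, t⟫))
  have h2 : stftCharacter η t = Complex.exp (Complex.I * (-(2 * π * ⟪η, t⟫) : ℝ)) := by
    rw [stftCharacter]
    push_cast
    ring_nf
  rw [h2]
  refine h.trans ?_
  rw [norm_neg, norm_mul, Real.norm_of_nonneg (by positivity), mul_assoc (2 * π) ‖η‖]
  exact mul_le_mul_of_nonneg_left (norm_inner_le_norm η t) (by positivity)

end Character

section Modulation

variable {E : Type*} [NormedAddCommGroup E] [InnerProductSpace ℝ E]

lemma exists_seminorm_modulation_le (G : 𝓢(E, ℂ)) (k n : ℕ) :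
    ∃ M : ℝ, 0 ≤ M ∧ ∀ (ξ : E) (ψ : 𝓢(E, ℂ)), (∀ t, ψ t = stftCharacter ξ t * G t) →
      SchwartzMap.seminorm ℂ k n ψ ≤ (1 + 2 * π * ‖ξ‖) ^ n * M := by
  obtain ⟨M, hM, h⟩ := exists_seminorm_mul_le G k n
  refine ⟨M, hM, fun ξ ψ hψ ↦ h (stftCharacter ξ) _ ψ (contDiff_stftCharacter ξ)
    (by positivity) (fun j hj t ↦ ?_) hψ⟩
  have h0 : 0 ≤ 2 * π * ‖ξ‖ := by positivity
  calc ‖iteratedFDeriv ℝ j (stftCharacter ξ) t‖ ≤ (2 * π * ‖ξ‖) ^ j :=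
        norm_iteratedFDeriv_stftCharacter_le ξ t j
    _ ≤ (1 + 2 * π * ‖ξ‖) ^ j := by gcongr; linarith
    _ ≤ (1 + 2 * π * ‖ξ‖) ^ n := pow_le_pow_right₀ (by linarith) hj
    _ ≤ (1 + 2 * π * ‖ξ‖) ^ n * (1 + ‖t‖) :=
        le_mul_of_one_le_right (by positivity) (by linarith [norm_nonneg t])

lemma norm_iteratedFDeriv_stftCharacter_sub_one_le (η t : E) {j n : ℕ} (hj : j ≤ n) :
    ‖iteratedFDeriv ℝ j (fun t ↦ stftCharacter η t - 1) t‖ ≤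
      2 * π * ‖η‖ * (1 + 2 * π * ‖η‖) ^ n * (1 + ‖t‖) := by
  have h0 : 0 ≤ 2 * π * ‖η‖ := by positivity
  have h1 : 1 ≤ (1 + 2 * π * ‖η‖) ^ n := one_le_pow₀ (by linarith)
  rcases j with _ | j
  · rw [norm_iteratedFDeriv_zero]
    calc ‖stftCharacter η t - 1‖ ≤ 2 * π * ‖η‖ * ‖t‖ := norm_stftCharacter_sub_one_le η t
      _ ≤ 2 * π * ‖η‖ * (1 + 2 * π * ‖η‖) ^ n * (1 + ‖t‖) := by
        exact mul_le_mul (le_mul_of_one_le_right h0 h1) (by linarith) (norm_nonneg t)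
          (by positivity)
  · have h2 : iteratedFDeriv ℝ (j + 1) (fun t ↦ stftCharacter η t - 1) t =
        iteratedFDeriv ℝ (j + 1) (stftCharacter η) t := by
      have := iteratedFDeriv_sub_apply (𝕜 := ℝ) (i := j + 1) (x := t)
        (((contDiff_stftCharacter η).of_le (mod_cast le_top)).contDiffAt)
        (contDiffAt_const (c := (1 : ℂ)))
      rw [iteratedFDeriv_const_of_ne (Nat.succ_ne_zero j)] at this
      exact this.trans (sub_zero _)
    rw [h2]
    calc ‖iteratedFDeriv ℝ (j + 1) (stftCharacter η) t‖ ≤ (2 * π * ‖η‖) ^ (j + 1) :=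
          norm_iteratedFDeriv_stftCharacter_le η t _
      _ = 2 * π * ‖η‖ * (2 * π * ‖η‖) ^ j := pow_succ' _ _
      _ ≤ 2 * π * ‖η‖ * (1 + 2 * π * ‖η‖) ^ n := by
        gcongr
        calc (2 * π * ‖η‖) ^ j ≤ (1 + 2 * π * ‖η‖) ^ j := by gcongr; linarith
          _ ≤ _ := pow_le_pow_right₀ (by linarith) (by omega)
      _ ≤ _ := le_mul_of_one_le_right (by positivity) (by linarith [norm_nonneg t])

lemma continuous_modulation {G : 𝓢(E, ℂ)} {W : E → 𝓢(E, ℂ)}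
    (hW : ∀ ξ t, W ξ t = stftCharacter ξ t * G t) : Continuous W := by
  refine continuous_iff_continuousAt.2 fun ξ₀ ↦ ?_
  refine ((schwartz_withSeminorms ℂ E ℂ).tendsto_nhds W (W ξ₀)).2 fun i ε hε ↦ ?_
  obtain ⟨M, hM, h⟩ := exists_seminorm_mul_le (W ξ₀) i.1 i.2
  have hlim : Tendsto (fun ξ ↦ 2 * π * ‖ξ - ξ₀‖ * (1 + 2 * π * ‖ξ - ξ₀‖) ^ i.2 * M) (𝓝 ξ₀)
      (𝓝 0) := by
    have hc : Continuous fun ξ ↦ 2 * π * ‖ξ - ξ₀‖ * (1 + 2 * π * ‖ξ - ξ₀‖) ^ i.2 * M := by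
      fun_prop
    simpa using hc.tendsto ξ₀
  filter_upwards [hlim.eventually_lt_const hε] with ξ hξ
  refine lt_of_le_of_lt ?_ hξ
  refine h (fun t ↦ stftCharacter (ξ - ξ₀) t - 1) _ _
    ((contDiff_stftCharacter _).sub contDiff_const) (by positivity)
    (fun j hj t ↦ norm_iteratedFDeriv_stftCharacter_sub_one_le _ t hj) fun t ↦ ?_
  have h2 := stftCharacter_add (ξ - ξ₀) ξ₀ t
  rw [sub_add_cancel] at h2
  rw [sub_apply, hW, hW, h2]
  ring

end Modulation

section Reconstruction

open scoped FourierTransform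

variable {E : Type*} [NormedAddCommGroup E] [InnerProductSpace ℝ E] [FiniteDimensional ℝ E]
  [MeasurableSpace E] [BorelSpace E]

lemma map_mul_eq_integral_fourier_mul (f : 𝓢(E, ℂ) →L[ℂ] ℂ) {G : 𝓢(E, ℂ)} {W : E → 𝓢(E, ℂ)}
    (hW : ∀ ξ t, W ξ t = stftCharacter ξ t * G t) (φ ψ : 𝓢(E, ℂ))
    (hψ : ∀ t, ψ t = φ t * G t) :
    f ψ = ∫ ξ, 𝓕 φ ξ * f (W (-ξ)) := by
  have hWc : Continuous W := continuous_modulation hW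
  have hΨ : Continuous fun ξ ↦ 𝓕 φ ξ • W (-ξ) :=
    (𝓕 φ).continuous.smul (hWc.comp continuous_neg)
  have key := map_eq_integral_of_forall_eq_integral (μ := volume) f hΨ (fun k n ↦ ?_) ψ ?_
  · simpa using key
  · obtain ⟨M, hM, h⟩ := exists_seminorm_modulation_le G k n
    have hp : Integrable (fun ξ ↦ ∑ j ∈ Finset.range (n + 1),
        ((2 * π) ^ j * (n.choose j) * M) * (‖ξ‖ ^ j * ‖𝓕 φ ξ‖)) :=
      integrable_finsetSum _ fun j _ ↦ ((𝓕 φ).integrable_pow_mul volume j).const_mul _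
    have hc : Continuous fun ξ ↦ SchwartzMap.seminorm ℂ k n (𝓕 φ ξ • W (-ξ)) :=
      ((schwartz_withSeminorms ℂ E ℂ).continuous_seminorm (k, n)).comp hΨ
    refine hp.mono' hc.aestronglyMeasurable (.of_forall fun ξ ↦ ?_)
    rw [Real.norm_of_nonneg (apply_nonneg _ _), map_smul_eq_mul]
    have h1 := h (-ξ) (W (-ξ)) (hW _)
    rw [norm_neg] at h1
    calc ‖𝓕 φ ξ‖ * SchwartzMap.seminorm ℂ k n (W (-ξ))
        ≤ ‖𝓕 φ ξ‖ * ((1 + 2 * π * ‖ξ‖) ^ n * M) := by gcongr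
      _ = _ := by
        rw [add_comm, add_pow, Finset.sum_mul, Finset.mul_sum]
        refine Finset.sum_congr rfl fun j _ ↦ ?_
        rw [one_pow, mul_pow]
        ring
  · intro t
    have h1 : φ t = 𝓕⁻ (⇑(𝓕 φ : 𝓢(E, ℂ))) t := by
      rw [← SchwartzMap.fourierInv_coe, FourierTransform.fourierInv_fourier_eq]
    rw [hψ, h1, Real.fourierInv_eq', ← integral_mul_const]
    refine integral_congr_ae (.of_forall fun ξ ↦ ?_)
    simp only [smul_apply, smul_eq_mul, hW, stftCharacter, inner_neg_left]
    rw [real_inner_comm]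
    push_cast
    ring_nf

lemma map_mul_eq_integral_mul (f : 𝓢(E, ℂ) →L[ℂ] ℂ) {G : 𝓢(E, ℂ)} {W : E → 𝓢(E, ℂ)}
    (hW : ∀ ξ t, W ξ t = stftCharacter ξ t * G t) (hint : Integrable fun ξ ↦ f (W (-ξ)))
    (φ ψ : 𝓢(E, ℂ)) (hψ : ∀ t, ψ t = φ t * G t) :
    f ψ = ∫ t, 𝓕 (fun ξ ↦ f (W (-ξ))) t * φ t := by
  rw [map_mul_eq_integral_fourier_mul f hW φ ψ hψ]
  have h := VectorFourier.integral_fourierIntegral_smul_eq_flip (e := Real.fourierChar)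
    (L := innerₗ E) (μ := (volume : Measure E)) (ν := (volume : Measure E))
    Real.continuous_fourierChar continuous_inner hint (φ.integrable)
  rw [flip_innerₗ] at h
  refine Eq.trans ?_ h.symm
  refine integral_congr_ae (.of_forall fun ξ ↦ ?_)
  simp only [smul_eq_mul]
  rw [mul_comm]
  rfl

end Reconstruction

section FourierBounds

open scoped FourierTransform

variable {E : Type*} [NormedAddCommGroup E] [InnerProductSpace ℝ E] [FiniteDimensional ℝ E]
  [MeasurableSpace E] [BorelSpace E]

lemma integrable_pow_mul_of_forall_pow_mul_le {V : E → ℂ} (hV : Continuous V) {C : ℕ → ℝ}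
    (hC : ∀ m ξ, ‖ξ‖ ^ m * ‖V ξ‖ ≤ C m) (k : ℕ) : Integrable fun ξ ↦ ‖ξ‖ ^ k * ‖V ξ‖ :=
  integrable_of_le_of_pow_mul_le (C₁ := C 0) (fun ξ ↦ by simpa using hC 0 ξ) (hC _)
    hV.aestronglyMeasurable

lemma contDiff_fourier_of_forall_pow_mul_le {V : E → ℂ} (hV : Continuous V) {C : ℕ → ℝ}
    (hC : ∀ m ξ, ‖ξ‖ ^ m * ‖V ξ‖ ≤ C m) : ContDiff ℝ ∞ (𝓕 V) :=
  Real.contDiff_fourier (N := ⊤) fun n _ ↦ integrable_pow_mul_of_forall_pow_mul_le hV hC n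

/-- Derivatives of Fourier transforms of rapidly decaying functions are bounded, uniformly
in the function as long as the decay constants are fixed. -/
lemma exists_norm_iteratedFDeriv_fourier_le (C : ℕ → ℝ) (n : ℕ) :
    ∃ K : ℝ, ∀ V : E → ℂ, Continuous V → (∀ m ξ, ‖ξ‖ ^ m * ‖V ξ‖ ≤ C m) →
      ∀ t, ‖iteratedFDeriv ℝ n (𝓕 V) t‖ ≤ K := by
  set N := (volume : Measure E).integrablePower
  refine ⟨(2 * π) ^ n * ∑ p ∈ Finset.range (n + 1) ×ˢ Finset.range 1,
    2 ^ N * (∫ x : E, (1 + ‖x‖) ^ (-(N : ℝ))) * (C 0 + C (p.1 + N)), fun V hV hC t ↦ ?_⟩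
  have h := Real.pow_mul_norm_iteratedFDeriv_fourier_le (f := V) (K := n) (N := 0) (k := n)
    (n := 0) (by simpa using hV) (fun k j _ hj ↦ by
      obtain rfl : j = 0 := by simpa using hj
      simpa only [norm_iteratedFDeriv_zero] using
        integrable_pow_mul_of_forall_pow_mul_le hV hC k) le_rfl le_rfl t
  rw [pow_zero, one_mul, pow_zero, mul_one] at h
  refine h.trans ?_
  refine mul_le_mul_of_nonneg_left (Finset.sum_le_sum fun ⟨k, j⟩ hp ↦ ?_) (by positivity)
  obtain rfl : j = 0 := Nat.lt_one_iff.1 (Finset.mem_range.1 (Finset.mem_product.1 hp).2)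
  simp only [norm_iteratedFDeriv_zero]
  exact integral_pow_mul_le_of_le_of_pow_mul_le (fun ξ ↦ by simpa using hC 0 ξ) (hC _)

lemma pow_mul_norm_fourier_le_of_integral_le {F : E → ℂ} (hF : ContDiff ℝ ∞ F)
    (hint : ∀ n, Integrable fun t ↦ ‖iteratedFDeriv ℝ n F t‖) {C : ℕ → ℝ}
    (hC : ∀ n, ∫ t, ‖iteratedFDeriv ℝ n F t‖ ≤ C n) (N : ℕ) (ξ : E) :
    ‖ξ‖ ^ N * ‖𝓕 F ξ‖ ≤ 2 ^ N * ∑ n ∈ Finset.range (N + 1), C n := by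
  have h := Real.pow_mul_norm_iteratedFDeriv_fourier_le (f := F) (K := 0) (N := N) (k := 0)
    (n := N) (hF.of_le (mod_cast le_top)) (fun k j hk _ ↦ by
      obtain rfl : k = 0 := by simpa using hk
      simpa using hint j) le_rfl le_rfl ξ
  rw [norm_iteratedFDeriv_zero] at h
  refine h.trans ?_
  simp only [zero_add, Finset.range_one, Finset.singleton_product, Finset.sum_map, pow_zero,
    one_mul, Function.Embedding.coeFn_mk, Nat.cast_zero, mul_zero]
  gcongr with n hn
  exact hC n

end FourierBounds

section SmoothBounded

open scoped FourierTransform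

variable {E : Type*} [NormedAddCommGroup E] [InnerProductSpace ℝ E] [FiniteDimensional ℝ E]
  [MeasurableSpace E] [BorelSpace E]

/-- Decay of the short-time Fourier transform of a smooth function with bounded derivatives,
uniformly in the position of the window. -/
lemma exists_pow_mul_norm_fourier_mul_translate_le {h : E → ℂ} (hh : ContDiff ℝ ∞ h) {B : ℕ → ℝ}
    (hB : ∀ n x, ‖iteratedFDeriv ℝ n h x‖ ≤ B n) (G : 𝓢(E, ℂ)) (N : ℕ) :
    ∃ K : ℝ, ∀ x ξ : E, ‖ξ‖ ^ N * ‖𝓕 (fun t ↦ h t * G (t - x)) ξ‖ ≤ K := by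
  have hGn (n : ℕ) : Integrable fun t ↦ ‖iteratedFDeriv ℝ n G t‖ := by
    simpa using G.integrable_pow_mul_iteratedFDeriv volume 0 n
  set C : ℕ → ℝ := fun n ↦ ∑ j ∈ Finset.range (n + 1),
    (n.choose j * B j) * ∫ t, ‖iteratedFDeriv ℝ (n - j) G t‖
  have hsm (x : E) : ContDiff ℝ ∞ fun t ↦ G (t - x) :=
    (G.smooth ⊤).comp (contDiff_id.sub contDiff_const)
  have hF (x : E) : ContDiff ℝ ∞ fun t ↦ h t * G (t - x) := hh.mul (hsm x)
  have hD (x t : E) (n : ℕ) : ‖iteratedFDeriv ℝ n (fun t ↦ h t * G (t - x)) t‖ ≤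
      ∑ j ∈ Finset.range (n + 1), (n.choose j * B j) * ‖iteratedFDeriv ℝ (n - j) G (t - x)‖ := by
    refine (norm_iteratedFDeriv_mul_le hh (hsm x) t (n := n) (mod_cast le_top)).trans ?_
    gcongr with j
    · exact mul_nonneg (Nat.cast_nonneg _) ((norm_nonneg _).trans (hB j t))
    · exact hB j t
    · rw [iteratedFDeriv_comp_sub]
  have hI (x : E) (n : ℕ) : Integrable fun t ↦ ∑ j ∈ Finset.range (n + 1),
      (n.choose j * B j) * ‖iteratedFDeriv ℝ (n - j) G (t - x)‖ :=
    integrable_finsetSum _ fun j _ ↦ ((hGn (n - j)).comp_sub_right x).const_mul _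
  refine ⟨2 ^ N * ∑ n ∈ Finset.range (N + 1), C n, fun x ξ ↦
    pow_mul_norm_fourier_le_of_integral_le (hF x) (fun n ↦ ?_) (fun n ↦ ?_) N ξ⟩
  · refine (hI x n).mono' ?_ (.of_forall fun t ↦ by rw [norm_norm]; exact hD x t n)
    exact ((hF x).continuous_iteratedFDeriv (mod_cast le_top)).norm.aestronglyMeasurable
  · refine (integral_mono_of_nonneg (.of_forall fun t ↦ norm_nonneg _) (hI x n)
      (.of_forall fun t ↦ hD x t n)).trans_eq ?_
    rw [integral_finsetSum _ fun j _ ↦ ((hGn (n - j)).comp_sub_right x).const_mul _]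
    refine Finset.sum_congr rfl fun j _ ↦ ?_
    rw [integral_const_mul, integral_sub_right_eq_self (fun t ↦ ‖iteratedFDeriv ℝ (n - j) G t‖) x]

end SmoothBounded

section JapaneseBracket

variable {E : Type*} [NormedAddCommGroup E]

lemma exists_japanese_bracket_rpow_mul_le {ι : Type*} {v : ι → E → ℂ}
    (hv : ∀ N : ℕ, ∃ K : ℝ, ∀ x ξ, ‖ξ‖ ^ N * ‖v x ξ‖ ≤ K) (s : ℝ) :
    ∃ C : ℝ, ∀ x ξ, (1 + ‖ξ‖ ^ 2) ^ (s / 2) * ‖v x ξ‖ ≤ C := by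
  choose K hK using hv
  obtain ⟨N, hN⟩ := exists_nat_ge (s / 2)
  refine ⟨∑ j ∈ Finset.range (N + 1), N.choose j * K (2 * j), fun x ξ ↦ ?_⟩
  calc (1 + ‖ξ‖ ^ 2) ^ (s / 2) * ‖v x ξ‖ ≤ (1 + ‖ξ‖ ^ 2) ^ (N : ℝ) * ‖v x ξ‖ := by
        gcongr
        linarith [sq_nonneg ‖ξ‖]
    _ = ∑ j ∈ Finset.range (N + 1), N.choose j * (‖ξ‖ ^ (2 * j) * ‖v x ξ‖) := by
        rw [Real.rpow_natCast, add_comm, add_pow, Finset.sum_mul]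
        refine Finset.sum_congr rfl fun j _ ↦ ?_
        rw [one_pow, ← pow_mul]
        ring
    _ ≤ _ := by
        gcongr with j
        exact hK (2 * j) x ξ

lemma exists_pow_mul_le_of_japanese_bracket {ι : Type*} {v : ι → E → ℂ}
    (hv : ∀ s : ℝ, 0 < s → ∃ C : ℝ, ∀ x ξ, (1 + ‖ξ‖ ^ 2) ^ (s / 2) * ‖v x ξ‖ ≤ C) (m : ℕ) :
    ∃ C : ℝ, ∀ x ξ, ‖ξ‖ ^ m * ‖v x ξ‖ ≤ C := by
  obtain ⟨C, hC⟩ := hv (2 * (m + 1)) (by positivity)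
  refine ⟨C, fun x ξ ↦ le_trans ?_ (hC x ξ)⟩
  gcongr
  have h1 : (2 * ((m : ℝ) + 1)) / 2 = ((m + 1 : ℕ) : ℝ) := by push_cast; ring
  rw [h1, Real.rpow_natCast]
  calc ‖ξ‖ ^ m ≤ (1 + ‖ξ‖ ^ 2) ^ m := by
        gcongr
        nlinarith [sq_nonneg (‖ξ‖ - 1), norm_nonneg ξ]
    _ ≤ _ := pow_le_pow_right₀ (by linarith [sq_nonneg ‖ξ‖]) (by omega)

end JapaneseBracket

section Cutoff

variable {E : Type*} [NormedAddCommGroup E] [InnerProductSpace ℝ E] [FiniteDimensional ℝ E]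

/-- Compactly supported functions are dense in the Schwartz space, by dominated cutoffs. -/
lemma exists_seq_hasCompactSupport_tendsto (φ : 𝓢(E, ℂ)) :
    ∃ Φ : ℕ → 𝓢(E, ℂ), (∀ m, HasCompactSupport (Φ m)) ∧ (∀ m t, ‖Φ m t‖ ≤ ‖φ t‖) ∧
      Tendsto Φ atTop (𝓝 φ) := by
  set χ : ContDiffBump (0 : E) := ⟨1, 2, one_pos, one_lt_two⟩
  set θ : E → ℂ := fun t ↦ (χ t : ℂ)
  have hθ : ContDiff ℝ ∞ θ := Complex.ofRealCLM.contDiff.comp χ.contDiff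
  have hθc : HasCompactSupport θ := χ.hasCompactSupport.comp_left Complex.ofReal_zero
  have hB (j : ℕ) : ∃ B, ∀ t, ‖iteratedFDeriv ℝ j θ t‖ ≤ B :=
    (hθ.continuous_iteratedFDeriv (mod_cast le_top)).bounded_above_of_compact_support
      (hθc.iteratedFDeriv j)
  choose B hB using hB
  have hB0 (j : ℕ) : 0 ≤ B j := (norm_nonneg _).trans (hB j 0)
  set ε : ℕ → ℝ := fun m ↦ 1 / ((m : ℝ) + 1)
  have hε0 (m : ℕ) : 0 < ε m := Nat.one_div_pos_of_nat
  have hε1 (m : ℕ) : ε m ≤ 1 := by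
    rw [div_le_one (by positivity)]
    linarith [(Nat.cast_nonneg m : (0 : ℝ) ≤ m)]
  have hs (m : ℕ) : ContDiff ℝ ∞ fun t ↦ θ (ε m • t) := hθ.comp (contDiff_const_smul _)
  have hsc (m : ℕ) : HasCompactSupport fun t ↦ θ (ε m • t) * φ t :=
    (hθc.comp_smul (hε0 m).ne').mul_right
  have hΦ (m : ℕ) : ContDiff ℝ ∞ fun t ↦ θ (ε m • t) * φ t := (hs m).mul (φ.smooth ⊤)
  refine ⟨fun m ↦ (hsc m).toSchwartzMap (hΦ m), fun m ↦ hsc m, fun m t ↦ ?_, ?_⟩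
  · change ‖θ (ε m • t) * φ t‖ ≤ _
    rw [norm_mul]
    refine mul_le_of_le_one_left (norm_nonneg _) ?_
    simp only [θ, Complex.norm_real, Real.norm_of_nonneg χ.nonneg]
    exact χ.le_one
  refine ((schwartz_withSeminorms ℂ E ℂ).tendsto_nhds _ φ).2 fun i δ hδ ↦ ?_
  obtain ⟨M, hM, h⟩ := exists_seminorm_mul_le φ i.1 i.2
  set K : ℝ := 1 + ∑ j ∈ Finset.range (i.2 + 1), B j
  have hS : 0 ≤ ∑ j ∈ Finset.range (i.2 + 1), B j := Finset.sum_nonneg fun j _ ↦ hB0 j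
  have hlim : Tendsto (fun m ↦ ε m * K * M) atTop (𝓝 0) := by
    simpa only [zero_mul] using
      ((tendsto_one_div_add_atTop_nhds_zero_nat (𝕜 := ℝ)).mul_const K).mul_const M
  filter_upwards [hlim.eventually_lt_const hδ] with m hm
  refine lt_of_le_of_lt ?_ hm
  refine h (fun t ↦ θ (ε m • t) - 1) _ _ ((hs m).sub contDiff_const)
    (mul_nonneg (hε0 m).le (by positivity)) (fun j hj t ↦ ?_) fun t ↦ ?_
  · rcases j with _ | j
    · rw [norm_iteratedFDeriv_zero]
      have h1 : ‖θ (ε m • t) - 1‖ ≤ ε m * ‖t‖ := by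
        have hn : ‖ε m • t‖ = ε m * ‖t‖ := by rw [norm_smul, Real.norm_of_nonneg (hε0 m).le]
        have h2 : ‖θ (ε m • t) - 1‖ = 1 - χ (ε m • t) := by
          simp only [θ]
          rw [← Complex.ofReal_one, ← Complex.ofReal_sub, Complex.norm_real, norm_sub_rev,
            Real.norm_of_nonneg (sub_nonneg.2 χ.le_one)]
        rw [h2, ← hn]
        rcases le_total ‖ε m • t‖ 1 with h3 | h3
        · rw [χ.one_of_mem_closedBall (by simpa using h3), sub_self]
          exact norm_nonneg _
        · linarith [χ.nonneg' (ε m • t)]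
      refine h1.trans ?_
      rw [mul_assoc]
      refine mul_le_mul_of_nonneg_left ?_ (hε0 m).le
      nlinarith [norm_nonneg t, mul_nonneg hS (norm_nonneg t)]
    · have h2 : iteratedFDeriv ℝ (j + 1) (fun t ↦ θ (ε m • t) - 1) t =
          iteratedFDeriv ℝ (j + 1) (fun t ↦ θ (ε m • t)) t := by
        have := iteratedFDeriv_sub_apply (𝕜 := ℝ) (i := j + 1) (x := t)
          (((hs m).of_le (mod_cast le_top)).contDiffAt) (contDiffAt_const (c := (1 : ℂ)))
        rw [iteratedFDeriv_const_of_ne (Nat.succ_ne_zero j)] at this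
        exact this.trans (sub_zero _)
      rw [h2, iteratedFDeriv_comp_const_smul (i := j + 1) (ε m) (hθ.of_le (mod_cast le_top)),
        norm_smul, norm_pow, Real.norm_of_nonneg (hε0 m).le]
      have h3 : B (j + 1) ≤ K := by
        have := Finset.single_le_sum (f := B) (fun j _ ↦ hB0 j)
          (Finset.mem_range.2 (Nat.lt_succ_of_le hj))
        linarith
      calc ε m ^ (j + 1) * ‖iteratedFDeriv ℝ (j + 1) θ (ε m • t)‖ ≤ ε m * K := by
            gcongr
            · exact pow_le_of_le_one (hε0 m).le (hε1 m) (Nat.succ_ne_zero j)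
            · exact (hB _ _).trans h3
        _ ≤ _ := le_mul_of_one_le_right (mul_nonneg (hε0 m).le (by positivity))
          (by linarith [norm_nonneg t])
  · change θ (ε m • t) * φ t - φ t = _
    ring

end Cutoff

section Quotient

variable {E : Type*} [NormedAddCommGroup E] [InnerProductSpace ℝ E] [FiniteDimensional ℝ E]
  [MeasurableSpace E] [BorelSpace E]

/-- If the products of a tempered distribution with all translates of a nonvanishing smooth
function `γ` are smooth with uniform derivative bounds, then the distribution is a smooth
function with bounded derivatives. -/
lemma exists_contDiff_of_map_mul_translate (f : 𝓢(E, ℂ) →L[ℂ] ℂ) {γ : E → ℂ}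
    (hγ : ContDiff ℝ ∞ γ) (hγ0 : ∀ t, γ t ≠ 0) {H : E → E → ℂ} (hH : ∀ x, ContDiff ℝ ∞ (H x))
    {K : ℕ → ℝ} (hK : ∀ n x t, ‖iteratedFDeriv ℝ n (H x) t‖ ≤ K n)
    (hf : ∀ x (φ ψ : 𝓢(E, ℂ)), (∀ t, ψ t = φ t * γ (t - x)) → f ψ = ∫ t, H x t * φ t) :
    ∃ h : E → ℂ, ContDiff ℝ ∞ h ∧ (∀ n, ∃ C : ℝ, ∀ t, ‖iteratedFDeriv ℝ n h t‖ ≤ C) ∧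
      ∀ φ : 𝓢(E, ℂ), f φ = ∫ t, h t * φ t := by
  have hγx (x : E) : ContDiff ℝ ∞ fun t ↦ γ (t - x) := hγ.comp (contDiff_id.sub contDiff_const)
  have hcross (x y t : E) : H x t * γ (t - y) = H y t * γ (t - x) := by
    have hc (x y : E) : Continuous fun t ↦ H x t * γ (t - y) :=
      (hH x).continuous.mul (hγx y).continuous
    have hae := ae_eq_of_integral_contDiff_smul_eq (μ := (volume : Measure E))
      (hc x y).locallyIntegrable (hc y x).locallyIntegrable fun g hg hgc ↦ ?_
    · exact congrFun ((hc x y).ae_eq_iff_eq volume (hc y x) |>.1 hae) t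
    have hgC : ContDiff ℝ ∞ fun t ↦ (g t : ℂ) := Complex.ofRealCLM.contDiff.comp hg
    have hgCc : HasCompactSupport fun t ↦ (g t : ℂ) := hgc.comp_left Complex.ofReal_zero
    have h1 (y : E) : HasCompactSupport fun t ↦ (g t : ℂ) * γ (t - y) := hgCc.mul_right
    set φ : E → 𝓢(E, ℂ) := fun y ↦ (h1 y).toSchwartzMap (hgC.mul (hγx y))
    have hφ (y t : E) : φ y t = g t * γ (t - y) := rfl
    set ψ : 𝓢(E, ℂ) := (hgCc.mul_right (f' := fun t ↦ γ (t - y) * γ (t - x))).toSchwartzMap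
      (hgC.mul ((hγx y).mul (hγx x)))
    have hψ (t : E) : ψ t = g t * (γ (t - y) * γ (t - x)) := rfl
    have e1 := hf x (φ y) ψ fun t ↦ by rw [hψ, hφ]; ring
    have e2 := hf y (φ x) ψ fun t ↦ by rw [hψ, hφ]; ring
    calc ∫ t, g t • (H x t * γ (t - y)) = ∫ t, H x t * φ y t := by
          congr 1 with t
          rw [hφ, Complex.real_smul]
          ring
      _ = ∫ t, H y t * φ x t := e1.symm.trans e2
      _ = _ := by
          congr 1 with t
          rw [hφ, Complex.real_smul]
          ring
  set h : E → ℂ := fun t ↦ H 0 t * (γ t)⁻¹ with hh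
  have hγi : ContDiff ℝ ∞ fun t ↦ (γ t)⁻¹ := hγ.inv hγ0
  have hhx (x : E) : h = fun t ↦ H x t * (γ (t - x))⁻¹ := by
    ext t
    have := hcross 0 x t
    rw [sub_zero] at this
    rw [hh]
    field_simp [hγ0 t, hγ0 (t - x)]
    rw [this, mul_comm]
  have hsm : ContDiff ℝ ∞ h := (hH 0).mul hγi
  have hbd (n : ℕ) : ∃ C : ℝ, ∀ t, ‖iteratedFDeriv ℝ n h t‖ ≤ C := by
    refine ⟨∑ j ∈ Finset.range (n + 1),
      n.choose j * K j * ‖iteratedFDeriv ℝ (n - j) (fun t ↦ (γ t)⁻¹) 0‖, fun t ↦ ?_⟩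
    rw [hhx t]
    refine (norm_iteratedFDeriv_mul_le (hH t) (hγi.comp (contDiff_id.sub contDiff_const)) t
      (n := n) (mod_cast le_top)).trans ?_
    refine Finset.sum_le_sum fun j _ ↦ ?_
    have h2 := congrArg norm (iteratedFDeriv_comp_sub (𝕜 := ℝ) (f := fun t ↦ (γ t)⁻¹) (n - j) t t)
    rw [sub_self] at h2
    refine mul_le_mul ?_ h2.le (norm_nonneg _) ?_
    · exact mul_le_mul_of_nonneg_left (hK j t t) (Nat.cast_nonneg _)
    · exact mul_nonneg (Nat.cast_nonneg _) ((norm_nonneg _).trans (hK j t t))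
  refine ⟨h, hsm, hbd, fun φ ↦ ?_⟩
  obtain ⟨Φ, hΦc, hΦle, hΦ⟩ := exists_seq_hasCompactSupport_tendsto φ
  have hΦf (m : ℕ) : f (Φ m) = ∫ t, h t * Φ m t := by
    have hc : HasCompactSupport fun t ↦ Φ m t * (γ t)⁻¹ := (hΦc m).mul_right
    have hs : ContDiff ℝ ∞ fun t ↦ Φ m t * (γ t)⁻¹ := ((Φ m).smooth ⊤).mul hγi
    have e := hf 0 (hc.toSchwartzMap hs) (Φ m) fun t ↦ by
      change _ = Φ m t * (γ t)⁻¹ * γ (t - 0)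
      rw [sub_zero, inv_mul_cancel_right₀ (hγ0 t)]
    rw [e]
    congr 1 with t
    change H 0 t * (Φ m t * (γ t)⁻¹) = _
    rw [hh]
    ring
  obtain ⟨C, hC⟩ := hbd 0
  refine tendsto_nhds_unique ((f.continuous.tendsto φ).comp hΦ) ?_
  have hlim : Tendsto (fun m ↦ ∫ t, h t * Φ m t) atTop (𝓝 (∫ t, h t * φ t)) := by
    refine tendsto_integral_of_dominated_convergence (fun t ↦ C * ‖φ t‖)
      (fun m ↦ (hsm.continuous.mul (Φ m).continuous).aestronglyMeasurable)
      (φ.integrable.norm.const_mul C) (fun m ↦ .of_forall fun t ↦ ?_) (.of_forall fun t ↦ ?_)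
    · rw [norm_mul]
      have h0 := hC t
      rw [norm_iteratedFDeriv_zero] at h0
      exact mul_le_mul h0 (hΦle m t) (norm_nonneg _) ((norm_nonneg _).trans h0)
    · exact (((continuous_schwartz_eval t).tendsto φ).comp hΦ).const_mul _
  exact hlim.congr fun m ↦ (hΦf m).symm

end Quotient

lemma gaussWindow_ne_zero {d : ℕ} (t : EuclideanSpace ℝ (Fin d)) : gaussWindow t ≠ 0 :=
  Complex.ofReal_ne_zero.2 (Real.exp_ne_zero _)

lemma contDiff_gaussWindow {d : ℕ} :
    ContDiff ℝ ∞ (gaussWindow : EuclideanSpace ℝ (Fin d) → ℂ) :=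
  Complex.ofRealCLM.contDiff.comp
    (Real.contDiff_exp.comp (contDiff_const.mul (contDiff_norm_sq ℝ)))

open scoped FourierTransform

/-- **`⋂_{s>0} M^∞_s(ℝ^d) = C^∞_b(ℝ^d)`**: a tempered distribution `f` satisfies
`sup_{(x,ξ)} ⟨ξ⟩^s |V_g f(x,ξ)| < ∞` for every `s > 0` if and only if `f` is (given by
integration against) a smooth function all of whose derivatives are bounded. The STFT of
`f` is `V_g f(x,ξ) = f(t ↦ e^{-2πiξ·t} g(t-x))`, the window being packaged as the
Schwartz function `w x ξ`; `⟨ξ⟩ = (1+|ξ|²)^{1/2}`. -/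
theorem inter_modulation_eq_smooth_bounded
    {d : ℕ} (hd : 1 ≤ d)
    (f : SchwartzMap (EuclideanSpace ℝ (Fin d)) ℂ →L[ℂ] ℂ)
    (w : EuclideanSpace ℝ (Fin d) → EuclideanSpace ℝ (Fin d) →
      SchwartzMap (EuclideanSpace ℝ (Fin d)) ℂ)
    (hw : ∀ x ξ t, w x ξ t =
      Complex.exp (-(((2 * π * ⟪ξ, t⟫ : ℝ) : ℂ) * Complex.I)) * gaussWindow (t - x)) :
    (∀ s : ℝ, 0 < s → ∃ C : ℝ,
        ∀ x ξ : EuclideanSpace ℝ (Fin d), (1 + ‖ξ‖ ^ 2) ^ (s / 2) * ‖f (w x ξ)‖ ≤ C) ↔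
      (∃ h : EuclideanSpace ℝ (Fin d) → ℂ,
        ContDiff ℝ (⊤ : ℕ∞) h ∧
        (∀ n : ℕ, ∃ C : ℝ, ∀ x, ‖iteratedFDeriv ℝ n h x‖ ≤ C) ∧
        ∀ φ : SchwartzMap (EuclideanSpace ℝ (Fin d)) ℂ, f φ = ∫ x, h x * φ x) := by
  have hw0 (x t : EuclideanSpace ℝ (Fin d)) : w x 0 t = gaussWindow (t - x) := by simp [hw]
  have hW (x ξ t : EuclideanSpace ℝ (Fin d)) : w x ξ t = stftCharacter ξ t * w x 0 t := by
    rw [hw0, hw, stftCharacter]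
  constructor
  · intro hs
    choose C hC using exists_pow_mul_le_of_japanese_bracket hs
    set V : EuclideanSpace ℝ (Fin d) → EuclideanSpace ℝ (Fin d) → ℂ := fun x ξ ↦ f (w x (-ξ))
    have hV (x : EuclideanSpace ℝ (Fin d)) : Continuous (V x) :=
      f.continuous.comp ((continuous_modulation (hW x)).comp continuous_neg)
    have hVC (x : EuclideanSpace ℝ (Fin d)) (m : ℕ) (ξ : EuclideanSpace ℝ (Fin d)) :
        ‖ξ‖ ^ m * ‖V x ξ‖ ≤ C m := by simpa using hC m x (-ξ)
    have hVi (x : EuclideanSpace ℝ (Fin d)) : Integrable (V x) := by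
      have := integrable_pow_mul_of_forall_pow_mul_le (hV x) (hVC x) 0
      simp only [pow_zero, one_mul] at this
      exact (integrable_norm_iff (hV x).aestronglyMeasurable).1 this
    choose K hK using exists_norm_iteratedFDeriv_fourier_le (E := EuclideanSpace ℝ (Fin d)) C
    refine exists_contDiff_of_map_mul_translate f contDiff_gaussWindow gaussWindow_ne_zero
      (H := fun x ↦ 𝓕 (V x)) (fun x ↦ contDiff_fourier_of_forall_pow_mul_le (hV x) (hVC x))
      (fun n x t ↦ hK n (V x) (hV x) (hVC x) t) fun x φ ψ hψ ↦ ?_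
    exact map_mul_eq_integral_mul f (hW x) (hVi x) φ ψ fun t ↦ by rw [hψ, hw0]
  · rintro ⟨h, hh, hB, hf⟩ s -
    choose B hB using hB
    have hF (x ξ : EuclideanSpace ℝ (Fin d)) :
        f (w x ξ) = 𝓕 (fun t ↦ h t * w 0 0 (t - x)) ξ := by
      rw [hf, Real.fourier_eq']
      congr 1 with t
      rw [hW, hw0, hw0, sub_zero, stftCharacter, real_inner_comm, smul_eq_mul]
      push_cast
      ring_nf
    refine exists_japanese_bracket_rpow_mul_le (fun N ↦ ?_) s
    simp only [hF]
    exact exists_pow_mul_norm_fourier_mul_translate_le hh hB (w 0 0) N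
end
end

section
/- Let s ≥ 0 and let σ ∈ 𝓢'(ℝ^{2d}) be a tempered distribution on ℝ^{2d}. Define the Gabor matrix of the Weyl operator σ^w by M(z,w) = | σ( W(π(z)g, π(w)g) ) | for z, w ∈ ℝ^{2d}, which equals |⟨σ^w π(z)g, π(w)g⟩|. Then the following are equivalent: (i) sup_{(u,ζ) ∈ ℝ^{4d}} ⟨ζ⟩^s |V_G σ(u,ζ)| < ∞ (i.e. σ ∈ M^∞_s(ℝ^{2d})); (ii) there exists C > 0 such that M(z,w) ≤ C ⟨w − z⟩^{−s} for all z, w ∈ ℝ^{2d}. (Almost diagonalization of Weyl operators with M^∞_s symbols by Gaussian time-frequency shifts.) -/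
open MeasureTheory Real Filter
open scoped RealInnerProductSpace ENNReal

noncomputable section

/-- The Gaussian window `G(u) = e^{-π|u|²}` on phase space `ℝ^{2d} = ℝ^d × ℝ^d`. -/
def gaussWindow2 {d : ℕ} (u : EuclideanSpace ℝ (Fin d) × EuclideanSpace ℝ (Fin d)) : ℂ :=
  (Real.exp (-π * (‖u.1‖ ^ 2 + ‖u.2‖ ^ 2)) : ℝ)

/-- The squared Euclidean norm on phase space `ℝ^{2d} = ℝ^d × ℝ^d`. -/
def sqNorm2 {d : ℕ} (z : EuclideanSpace ℝ (Fin d) × EuclideanSpace ℝ (Fin d)) : ℝ :=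
  ‖z.1‖ ^ 2 + ‖z.2‖ ^ 2

lemma norm_pow_norm_smul {V W : Type*} [NormedAddCommGroup V] [NormedAddCommGroup W]
    [NormedSpace ℝ W] (v : V) (k : ℕ) (a : W) : ‖‖v‖ ^ k • a‖ = ‖v‖ ^ k * ‖a‖ := by
  rw [norm_smul, norm_pow, norm_norm]

lemma norm_pow_norm_smul_sub {V W : Type*} [NormedAddCommGroup V] [NormedAddCommGroup W]
    [NormedSpace ℝ W] (v : V) (k : ℕ) (a b : W) :
    ‖‖v‖ ^ k • a - ‖v‖ ^ k • b‖ = ‖v‖ ^ k * ‖a - b‖ := by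
  rw [← smul_sub, norm_pow_norm_smul]

section Slices

variable {P V : Type*} [NormedAddCommGroup P] [NormedSpace ℝ P]
  [NormedAddCommGroup V] [NormedSpace ℝ V]

/-- The derivatives of a slice of a Schwartz function of two variables. -/
lemma iteratedFDeriv_slice (Φ : SchwartzMap (P × V) ℂ) (p : P) (l : ℕ) (v : V) :
    iteratedFDeriv ℝ l (fun v => Φ (p, v)) v =
      ContinuousMultilinearMap.compContinuousLinearMapL (F := ℂ)
        (fun _ : Fin l => ContinuousLinearMap.inr ℝ P V) (iteratedFDeriv ℝ l Φ (p, v)) := by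
  have hΦ : ContDiff ℝ l (fun z => Φ ((p, 0) + z)) :=
    (Φ.smooth l).comp (contDiff_const.add contDiff_id)
  have h := (ContinuousLinearMap.inr ℝ P V).iteratedFDeriv_comp_right hΦ v le_rfl
  rw [iteratedFDeriv_comp_add_left] at h
  simpa [Function.comp_def] using h

lemma norm_compContinuousLinearMapL_inr_le (l : ℕ)
    (A : ContinuousMultilinearMap ℝ (fun _ : Fin l => P × V) ℂ) :
    ‖ContinuousMultilinearMap.compContinuousLinearMapL (F := ℂ)
        (fun _ : Fin l => ContinuousLinearMap.inr ℝ P V) A‖ ≤ ‖A‖ := by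
  refine (A.norm_compContinuousLinearMap_le _).trans ?_
  refine mul_le_of_le_one_right (norm_nonneg _) (Finset.prod_le_one (by simp) fun i _ => ?_)
  exact ContinuousLinearMap.norm_inr_le_one ℝ P V

lemma pow_mul_norm_iteratedFDeriv_slice_le (Φ : SchwartzMap (P × V) ℂ) (n k l : ℕ) (p : P)
    (v : V) :
    ‖p‖ ^ n * (‖v‖ ^ k * ‖iteratedFDeriv ℝ l (fun v => Φ (p, v)) v‖) ≤
      SchwartzMap.seminorm ℝ (n + k) l Φ := by
  rw [iteratedFDeriv_slice]
  calc _ ≤ ‖(p, v)‖ ^ n * (‖(p, v)‖ ^ k * ‖iteratedFDeriv ℝ l Φ (p, v)‖) := by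
        gcongr
        · exact norm_fst_le (p, v)
        · exact norm_snd_le (p, v)
        · exact norm_compContinuousLinearMapL_inr_le l _
    _ ≤ _ := by
        rw [← mul_assoc, ← pow_add]
        exact Φ.le_seminorm ℝ _ _ _

/-- Slices of a Schwartz function depend in a Lipschitz way on the parameter. -/
lemma pow_mul_norm_iteratedFDeriv_slice_sub_le (Φ : SchwartzMap (P × V) ℂ) (k l : ℕ) (p q : P)
    (v : V) :
    ‖v‖ ^ k * ‖iteratedFDeriv ℝ l (fun v => Φ (p, v)) v -
        iteratedFDeriv ℝ l (fun v => Φ (q, v)) v‖ ≤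
      SchwartzMap.seminorm ℝ k (l + 1) Φ * ‖p - q‖ := by
  rw [iteratedFDeriv_slice, iteratedFDeriv_slice, ← map_sub]
  have hd (x : P × V) : DifferentiableAt ℝ (iteratedFDeriv ℝ l Φ) x :=
    ((Φ.smooth (l + 1 : ℕ)).differentiable_iteratedFDeriv (by exact_mod_cast Nat.lt_succ_self l)) x
  have hder (x : P) : HasFDerivAt (fun p => ‖v‖ ^ k • iteratedFDeriv ℝ l Φ (p, v))
      (‖v‖ ^ k • (fderiv ℝ (iteratedFDeriv ℝ l Φ) (x, v)).comp
        (ContinuousLinearMap.inl ℝ P V)) x :=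
    (HasFDerivAt.comp (f := fun p => (p, v)) x (hd (x, v)).hasFDerivAt
      (hasFDerivAt_prodMk_left x v)).fun_const_smul _
  have hb (x : P) : ‖‖v‖ ^ k • (fderiv ℝ (iteratedFDeriv ℝ l Φ) (x, v)).comp
        (ContinuousLinearMap.inl ℝ P V)‖ ≤ SchwartzMap.seminorm ℝ k (l + 1) Φ := by
    refine (norm_pow_norm_smul
      (W := P →L[ℝ] ContinuousMultilinearMap ℝ (fun _ : Fin l => P × V) ℂ) v k _).trans_le ?_
    refine le_trans ?_ (Φ.le_seminorm ℝ k (l + 1) (x, v))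
    rw [← norm_fderiv_iteratedFDeriv]
    gcongr
    · exact norm_snd_le (x, v)
    · refine (ContinuousLinearMap.opNorm_comp_le _ _).trans ?_
      exact mul_le_of_le_one_right (norm_nonneg _) (ContinuousLinearMap.norm_inl_le_one ℝ P V)
  have := Convex.norm_image_sub_le_of_norm_hasFDerivWithin_le (s := Set.univ) (x := q) (y := p)
    (fun x _ => (hder x).hasFDerivWithinAt) (fun x _ => hb x) convex_univ trivial trivial
  refine le_trans ?_ this
  rw [← smul_sub, norm_smul, norm_pow, norm_norm]
  gcongr
  exact norm_compContinuousLinearMapL_inr_le l _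

lemma continuous_iteratedFDeriv_slice (Φ : SchwartzMap (P × V) ℂ) (l : ℕ) (v : V) :
    Continuous fun p => iteratedFDeriv ℝ l (fun v => Φ (p, v)) v := by
  simp_rw [iteratedFDeriv_slice]
  exact (ContinuousLinearMap.continuous _).comp
    (((Φ.smooth l).continuous_iteratedFDeriv le_rfl).comp (Continuous.prodMk_left v))

variable [MeasurableSpace P] (μ : Measure P) [μ.HasTemperateGrowth]

lemma exists_integrable_bound_slice (Φ : SchwartzMap (P × V) ℂ) (k l : ℕ) :
    ∃ b : P → ℝ, Integrable b μ ∧ ∀ p v,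
      ‖v‖ ^ k * ‖iteratedFDeriv ℝ l (fun v => Φ (p, v)) v‖ ≤ b p := by
  refine ⟨_, (μ.integrable_pow_neg_integrablePower).const_mul
    (2 ^ μ.integrablePower * (SchwartzMap.seminorm ℝ (0 + k) l Φ +
      SchwartzMap.seminorm ℝ (μ.integrablePower + k) l Φ)), fun p v => ?_⟩
  have := pow_mul_le_of_le_of_pow_mul_le (k := 0) (l := μ.integrablePower) (norm_nonneg p)
    (mul_nonneg (pow_nonneg (norm_nonneg v) k) (norm_nonneg _))
    (by simpa using pow_mul_norm_iteratedFDeriv_slice_le Φ 0 k l p v)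
    (by simpa using pow_mul_norm_iteratedFDeriv_slice_le Φ μ.integrablePower k l p v)
  simpa using this

variable [BorelSpace P] [SecondCountableTopology P]

lemma integrable_iteratedFDeriv_slice (Φ : SchwartzMap (P × V) ℂ) (l : ℕ) (v : V) :
    Integrable (fun p => iteratedFDeriv ℝ l (fun v => Φ (p, v)) v) μ := by
  obtain ⟨b, hb, h⟩ := exists_integrable_bound_slice μ Φ 0 l
  exact hb.mono' (continuous_iteratedFDeriv_slice Φ l v).aestronglyMeasurable
    (.of_forall fun p => by simpa using h p v)

/-- Differentiation under the integral sign for Schwartz functions of two variables. -/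
lemma iteratedFDeriv_integral_slice (Φ : SchwartzMap (P × V) ℂ) (l : ℕ) (v : V) :
    iteratedFDeriv ℝ l (fun v => ∫ p, Φ (p, v) ∂μ) v =
      ∫ p, iteratedFDeriv ℝ l (fun v => Φ (p, v)) v ∂μ := by
  induction l generalizing v with
  | zero =>
    simp only [iteratedFDeriv_zero_eq_comp, Function.comp_def]
    exact (((continuousMultilinearCurryFin0 ℝ V ℂ).symm.toContinuousLinearEquiv).integral_comp_comm
      _).symm
  | succ l ih =>
    obtain ⟨b, hb, h⟩ := exists_integrable_bound_slice μ Φ 0 (l + 1)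
    have hsm (p : P) : ContDiff ℝ (l + 1 : ℕ) (fun v => Φ (p, v)) :=
      (Φ.smooth _).comp (by fun_prop)
    have hfd (p : P) : fderiv ℝ (iteratedFDeriv ℝ l fun v => Φ (p, v)) v =
        continuousMultilinearCurryLeftEquiv ℝ (fun _ => V) ℂ
          (iteratedFDeriv ℝ (l + 1) (fun v => Φ (p, v)) v) := by
      rw [iteratedFDeriv_succ_eq_comp_left]; simp
    have key := hasFDerivAt_integral_of_dominated_of_fderiv_le (𝕜 := ℝ) (μ := μ) (x₀ := v)
      (s := Set.univ) (bound := b)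
      (F := fun v p => iteratedFDeriv ℝ l (fun v => Φ (p, v)) v)
      (F' := fun v p => fderiv ℝ (iteratedFDeriv ℝ l fun v => Φ (p, v)) v) univ_mem
      (.of_forall fun v => (continuous_iteratedFDeriv_slice Φ l v).aestronglyMeasurable)
      (integrable_iteratedFDeriv_slice μ Φ l v)
      (by
        simp_rw [hfd]
        exact ((LinearIsometryEquiv.continuous _).comp
          (continuous_iteratedFDeriv_slice Φ (l + 1) v)).aestronglyMeasurable)
      (.of_forall fun p v _ => by
        rw [norm_fderiv_iteratedFDeriv]; simpa using h p v) hb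
      (.of_forall fun p v _ => (((hsm p).differentiable_iteratedFDeriv
        (by exact_mod_cast Nat.lt_succ_self l)) v).hasFDerivAt)
    rw [iteratedFDeriv_succ_eq_comp_left, Function.comp_apply, funext ih, key.fderiv]
    simp_rw [iteratedFDeriv_succ_eq_comp_left, Function.comp_apply]
    exact (ContinuousLinearEquiv.integral_comp_comm (𝕜 := ℝ) (μ := μ)
      (E := V →L[ℝ] ContinuousMultilinearMap ℝ (fun _ : Fin l => V) ℂ)
      (F := ContinuousMultilinearMap ℝ (fun _ : Fin (l + 1) => V) ℂ)
      (continuousMultilinearCurryLeftEquiv ℝ (fun _ : Fin (l + 1) => V)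
        ℂ).symm.toContinuousLinearEquiv _).symm

end Slices

section Fubini

variable {P V : Type*} [NormedAddCommGroup P] [NormedSpace ℝ P]
  [NormedAddCommGroup V] [NormedSpace ℝ V]

/-- Bounded continuous functions with values in the continuous `l`-linear forms on `V`. -/
abbrev BoundedForms (V : Type*) [NormedAddCommGroup V] [NormedSpace ℝ V] (l : ℕ) :=
  @BoundedContinuousFunction V (ContinuousMultilinearMap ℝ (fun _ : Fin l => V) ℂ) _
    NormedAddCommGroup.toSeminormedAddCommGroup.toPseudoMetricSpace

/-- The weighted derivative `v ↦ ‖v‖ ^ k • D^l f v` as a bounded continuous function. -/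
def weightedDeriv (k l : ℕ) : SchwartzMap V ℂ →ₗ[ℂ] BoundedForms V l where
  toFun f := BoundedContinuousFunction.ofNormedAddCommGroup
    (fun v => ‖v‖ ^ k • iteratedFDeriv ℝ l f v)
    ((continuous_norm.pow k).smul ((f.smooth l).continuous_iteratedFDeriv le_rfl))
    (SchwartzMap.seminorm ℝ k l f) (fun v => by
      rw [norm_smul, norm_pow, norm_norm]; exact f.le_seminorm ℝ k l v)
  map_add' f g := by
    ext1 v
    change ‖v‖ ^ k • iteratedFDeriv ℝ l (f + g : V → ℂ) v =
      ‖v‖ ^ k • iteratedFDeriv ℝ l f v + ‖v‖ ^ k • iteratedFDeriv ℝ l g v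
    rw [iteratedFDeriv_add_apply (f.smooth l).contDiffAt (g.smooth l).contDiffAt, smul_add]
  map_smul' c f := by
    ext1 v
    change ‖v‖ ^ k • iteratedFDeriv ℝ l (c • f : V → ℂ) v =
      c • (‖v‖ ^ k • iteratedFDeriv ℝ l f v)
    rw [iteratedFDeriv_const_smul_apply (f.smooth l).contDiffAt, smul_comm]

lemma weightedDeriv_apply (k l : ℕ) (f : SchwartzMap V ℂ) (v : V) :
    weightedDeriv k l f v = ‖v‖ ^ k • iteratedFDeriv ℝ l f v := rfl

/-- A tempered distribution factors through finitely many weighted derivatives. -/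
lemma exists_factor_weightedDeriv (σ : SchwartzMap V ℂ →L[ℂ] ℂ) :
    ∃ (s : Finset (ℕ × ℕ)) (τ : ((i : s) → BoundedForms V i.1.2) →L[ℂ] ℂ),
      ∀ f, σ f = τ (fun i => weightedDeriv i.1.1 i.1.2 f) := by
  obtain ⟨s, C, -, hC⟩ := Seminorm.bound_of_continuous (schwartz_withSeminorms ℂ V ℂ)
    ((normSeminorm ℂ ℂ).comp (σ : SchwartzMap V ℂ →ₗ[ℂ] ℂ)) (continuous_norm.comp σ.continuous)
  let T : SchwartzMap V ℂ →ₗ[ℂ] ((i : s) → BoundedForms V i.1.2) :=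
    LinearMap.pi fun i => weightedDeriv i.1.1 i.1.2
  have hT (f : SchwartzMap V ℂ) : (s.sup (schwartzSeminormFamily ℂ V ℂ)) f ≤ ‖T f‖ := by
    refine Seminorm.finset_sup_apply_le (norm_nonneg _) fun i hi => ?_
    refine SchwartzMap.seminorm_le_bound ℂ _ _ f (norm_nonneg _) fun v => ?_
    calc ‖v‖ ^ i.1 * ‖iteratedFDeriv ℝ i.2 f v‖ = ‖T f ⟨i, hi⟩ v‖ := by
          change _ = ‖‖v‖ ^ i.1 • iteratedFDeriv ℝ i.2 f v‖
          rw [norm_smul, norm_pow, norm_norm]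
      _ ≤ ‖T f ⟨i, hi⟩‖ := BoundedContinuousFunction.norm_coe_le_norm _ _
      _ ≤ ‖T f‖ := norm_le_pi_norm _ _
  have hσ : ∃ C, ∀ f, ‖(σ : SchwartzMap V ℂ →ₗ[ℂ] ℂ) f‖ ≤ C * ‖T f‖ :=
    ⟨C, fun f => (hC f).trans (mul_le_mul_of_nonneg_left (hT f) C.2)⟩
  obtain ⟨τ, hτ, -⟩ := exists_extension_norm_eq (LinearMap.range T)
    ((σ : SchwartzMap V ℂ →ₗ[ℂ] ℂ).compLeftInverse T)
  refine ⟨s, τ, fun f => ?_⟩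
  have := hτ ⟨T f, LinearMap.mem_range_self T f⟩
  rw [LinearMap.compLeftInverse_apply_of_bdd _ _ hσ f _ rfl] at this
  exact this.symm

variable [MeasurableSpace P] [BorelSpace P] [SecondCountableTopology P]
  (μ : Measure P) [μ.HasTemperateGrowth]

/-- A tempered distribution commutes with integration of a Schwartz function of two variables
over one of them. -/
theorem map_integral_slice (σ : SchwartzMap V ℂ →L[ℂ] ℂ) (Φ : SchwartzMap (P × V) ℂ)
    (φ : P → SchwartzMap V ℂ) (hφ : ∀ p v, φ p v = Φ (p, v)) (F : SchwartzMap V ℂ)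
    (hF : ∀ v, F v = ∫ p, Φ (p, v) ∂μ) : σ F = ∫ p, σ (φ p) ∂μ := by
  obtain ⟨s, τ, hτ⟩ := exists_factor_weightedDeriv σ
  have hφ' (p : P) : (φ p : V → ℂ) = fun v => Φ (p, v) := funext (hφ p)
  have hcont (k l : ℕ) : Continuous fun p => weightedDeriv k l (φ p) := by
    refine (LipschitzWith.of_dist_le_mul (K := (SchwartzMap.seminorm ℝ k (l + 1) Φ).toNNReal)
      fun p q => ?_).continuous
    refine (BoundedContinuousFunction.dist_le (by positivity)).2 fun v => ?_
    rw [weightedDeriv_apply, weightedDeriv_apply, dist_eq_norm, dist_eq_norm, hφ', hφ',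
      Real.coe_toNNReal _ (apply_nonneg _ _)]
    refine (norm_pow_norm_smul_sub v k _ _).trans_le ?_
    exact pow_mul_norm_iteratedFDeriv_slice_sub_le Φ k l p q v
  have hint (k l : ℕ) : Integrable (fun p => weightedDeriv k l (φ p)) μ := by
    obtain ⟨b, hb, h⟩ := exists_integrable_bound_slice μ Φ k l
    refine hb.mono' (hcont k l).aestronglyMeasurable (.of_forall fun p => ?_)
    refine (BoundedContinuousFunction.norm_le ((by positivity : (0 : ℝ) ≤ _).trans (h p 0))).2
      fun v => ?_
    rw [weightedDeriv_apply, norm_smul, norm_pow, norm_norm, hφ']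
    exact h p v
  have hI (k l : ℕ) : weightedDeriv k l F = ∫ p, weightedDeriv k l (φ p) ∂μ := by
    ext1 v
    have := (BoundedContinuousFunction.evalCLM ℝ v).integral_comp_comm (hint k l)
    simp only [BoundedContinuousFunction.evalCLM_apply] at this
    rw [← this]
    simp_rw [weightedDeriv_apply, hφ', integral_smul, ← iteratedFDeriv_integral_slice]
    rw [show (F : V → ℂ) = fun v => ∫ p, Φ (p, v) ∂μ from funext hF]
  simp_rw [hτ]
  rw [τ.integral_comp_comm (Integrable.of_eval fun i => hint i.1.1 i.1.2)]
  congr 1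
  ext1 i
  rw [hI, eval_integral fun i => hint i.1.1 i.1.2]

end Fubini

section Constructions

/-- The tensor product `(p, v) ↦ a p * b v` of two Schwartz functions. -/
def schwartzTensor {P V : Type*} [NormedAddCommGroup P] [NormedSpace ℝ P]
    [NormedAddCommGroup V] [NormedSpace ℝ V] (a : SchwartzMap P ℂ) (b : SchwartzMap V ℂ) :
    SchwartzMap (P × V) ℂ where
  toFun x := a x.1 * b x.2
  smooth' := ((a.smooth ⊤).comp contDiff_fst).mul ((b.smooth ⊤).comp contDiff_snd)
  decay' k n := by
    have hfst (i : ℕ) (x : P × V) :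
        ‖iteratedFDeriv ℝ i (fun x : P × V => a x.1) x‖ ≤ ‖iteratedFDeriv ℝ i a x.1‖ := by
      have := (ContinuousLinearMap.fst ℝ P V).iteratedFDeriv_comp_right (a.smooth i) x le_rfl
      change ‖iteratedFDeriv ℝ i (a ∘ ContinuousLinearMap.fst ℝ P V) x‖ ≤ _
      rw [this]
      refine (ContinuousMultilinearMap.norm_compContinuousLinearMap_le _ _).trans ?_
      exact mul_le_of_le_one_right (norm_nonneg _)
        (Finset.prod_le_one (by simp) fun _ _ => ContinuousLinearMap.norm_fst_le ℝ P V)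
    have hsnd (i : ℕ) (x : P × V) :
        ‖iteratedFDeriv ℝ i (fun x : P × V => b x.2) x‖ ≤ ‖iteratedFDeriv ℝ i b x.2‖ := by
      have := (ContinuousLinearMap.snd ℝ P V).iteratedFDeriv_comp_right (b.smooth i) x le_rfl
      change ‖iteratedFDeriv ℝ i (b ∘ ContinuousLinearMap.snd ℝ P V) x‖ ≤ _
      rw [this]
      refine (ContinuousMultilinearMap.norm_compContinuousLinearMap_le _ _).trans ?_
      exact mul_le_of_le_one_right (norm_nonneg _)
        (Finset.prod_le_one (by simp) fun _ _ => ContinuousLinearMap.norm_snd_le ℝ P V)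
    have hpow (x : P × V) : ‖x‖ ^ k ≤ ‖x.1‖ ^ k + ‖x.2‖ ^ k := by
      rcases le_total ‖x.1‖ ‖x.2‖ with h | h
      · rw [Prod.norm_def, max_eq_right h]; exact le_add_of_nonneg_left (by positivity)
      · rw [Prod.norm_def, max_eq_left h]; exact le_add_of_nonneg_right (by positivity)
    refine ⟨∑ i ∈ Finset.range (n + 1), (n.choose i : ℝ) *
      (SchwartzMap.seminorm ℝ k i a * SchwartzMap.seminorm ℝ 0 (n - i) b +
        SchwartzMap.seminorm ℝ 0 i a * SchwartzMap.seminorm ℝ k (n - i) b), fun x => ?_⟩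
    have hprod := norm_iteratedFDeriv_mul_le (𝕜 := ℝ) (f := fun x : P × V => a x.1)
      (g := fun x : P × V => b x.2) (N := n) ((a.smooth n).comp contDiff_fst)
      ((b.smooth n).comp contDiff_snd) x le_rfl
    refine (mul_le_mul_of_nonneg_left hprod (by positivity)).trans ?_
    rw [Finset.mul_sum]
    refine Finset.sum_le_sum fun i _ => ?_
    have ha0 := a.le_seminorm ℝ 0 i x.1
    have hak := a.le_seminorm ℝ k i x.1
    have hb0 := b.le_seminorm ℝ 0 (n - i) x.2
    have hbk := b.le_seminorm ℝ k (n - i) x.2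
    rw [pow_zero, one_mul] at ha0 hb0
    calc _ ≤ (‖x.1‖ ^ k + ‖x.2‖ ^ k) * ((n.choose i : ℝ) * ‖iteratedFDeriv ℝ i a x.1‖ *
          ‖iteratedFDeriv ℝ (n - i) b x.2‖) := by
          gcongr
          · exact hpow x
          · exact hfst i x
          · exact hsnd (n - i) x
      _ = (n.choose i : ℝ) * ((‖x.1‖ ^ k * ‖iteratedFDeriv ℝ i a x.1‖) *
            ‖iteratedFDeriv ℝ (n - i) b x.2‖ +
          ‖iteratedFDeriv ℝ i a x.1‖ * (‖x.2‖ ^ k * ‖iteratedFDeriv ℝ (n - i) b x.2‖)) := by ring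
      _ ≤ _ := by gcongr

lemma schwartzTensor_apply {P V : Type*} [NormedAddCommGroup P] [NormedSpace ℝ P]
    [NormedAddCommGroup V] [NormedSpace ℝ V] (a : SchwartzMap P ℂ) (b : SchwartzMap V ℂ)
    (x : P × V) : schwartzTensor a b x = a x.1 * b x.2 := rfl

lemma iteratedDeriv_cexp_ofReal_mul_I (n : ℕ) :
    iteratedDeriv n (fun t : ℝ => Complex.exp (t * Complex.I)) =
      fun t : ℝ => Complex.I ^ n * Complex.exp (t * Complex.I) := by
  induction n with
  | zero => simp
  | succ n ih =>
    rw [iteratedDeriv_succ, ih]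
    ext t
    have h : HasDerivAt (fun t : ℝ => Complex.exp (t * Complex.I))
        (Complex.exp (t * Complex.I) * (1 * Complex.I)) t :=
      (((hasDerivAt_id (t : ℂ)).comp_ofReal).mul_const Complex.I).cexp
    rw [(h.const_mul _).deriv]
    ring

lemma hasTemperateGrowth_cexp_ofReal_mul_I :
    (fun t : ℝ => Complex.exp (t * Complex.I)).HasTemperateGrowth := by
  refine ⟨((Complex.ofRealCLM.contDiff).mul contDiff_const).cexp, fun n => ⟨0, 1, fun t => ?_⟩⟩
  rw [norm_iteratedFDeriv_eq_norm_iteratedDeriv, iteratedDeriv_cexp_ofReal_mul_I]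
  simp [Complex.norm_exp_ofReal_mul_I]

lemma Function.HasTemperateGrowth.cexp_mul_I {V : Type*} [NormedAddCommGroup V] [NormedSpace ℝ V]
    {q : V → ℝ} (hq : q.HasTemperateGrowth) :
    (fun x => Complex.exp (q x * Complex.I)).HasTemperateGrowth :=
  hasTemperateGrowth_cexp_ofReal_mul_I.comp hq

end Constructions

section Gaussian

variable {d : ℕ}

lemma gaussWindow2_eq_mul (v : EuclideanSpace ℝ (Fin d) × EuclideanSpace ℝ (Fin d)) :
    gaussWindow2 v = gaussWindow v.1 * gaussWindow v.2 := by
  rw [gaussWindow2, gaussWindow, gaussWindow, ← Complex.ofReal_mul, ← Real.exp_add]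
  congr 2; ring

lemma integral_cexp_mul_gaussWindow (x : EuclideanSpace ℝ (Fin d)) :
    ∫ η, Complex.exp (-(((2 * π * ⟪η, x⟫ : ℝ) : ℂ) * Complex.I)) * gaussWindow η =
      gaussWindow x := by
  have h := GaussianFourier.integral_cexp_neg_mul_sq_norm_add (b := (π : ℂ))
    (by simpa using Real.pi_pos) (-2 * π * Complex.I) x
  have hpi : (π : ℂ) ≠ 0 := by exact_mod_cast Real.pi_ne_zero
  rw [div_self hpi, Complex.one_cpow, one_mul] at h
  convert! h using 1
  · congr 1
    ext η
    rw [gaussWindow, Complex.ofReal_exp, ← Complex.exp_add, real_inner_comm]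
    congr 1; push_cast; ring
  · rw [gaussWindow, Complex.ofReal_exp]
    congr 1
    push_cast
    field_simp
    rw [Complex.I_sq]; ring

/-- The Gaussian on phase space is its own Fourier transform. -/
lemma integral_cexp_mul_gaussWindow2 (x : EuclideanSpace ℝ (Fin d) × EuclideanSpace ℝ (Fin d)) :
    ∫ η : EuclideanSpace ℝ (Fin d) × EuclideanSpace ℝ (Fin d),
      Complex.exp (-(((2 * π * (⟪η.1, x.1⟫ + ⟪η.2, x.2⟫) : ℝ) : ℂ) * Complex.I)) *
        gaussWindow2 η = gaussWindow2 x := by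
  rw [gaussWindow2_eq_mul x, ← integral_cexp_mul_gaussWindow, ← integral_cexp_mul_gaussWindow,
    ← integral_prod_mul, ← Measure.volume_eq_prod]
  congr 1
  ext η
  rw [gaussWindow2_eq_mul, mul_mul_mul_comm, ← Complex.exp_add]
  congr 2; push_cast; ring

instance isAddHaarMeasure_volume_phaseSpace :
    (volume : Measure (EuclideanSpace ℝ (Fin d) × EuclideanSpace ℝ (Fin d))).IsAddHaarMeasure :=
  inferInstanceAs
    (Measure.prod (volume : Measure (EuclideanSpace ℝ (Fin d))) volume).IsAddHaarMeasure

lemma integral_gaussWindow2_two_smul_ne_zero :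
    ∫ p : EuclideanSpace ℝ (Fin d) × EuclideanSpace ℝ (Fin d),
      gaussWindow2 ((2 : ℝ) • p) ≠ 0 := by
  have h := integral_cexp_mul_gaussWindow2 (0 : EuclideanSpace ℝ (Fin d) × EuclideanSpace ℝ (Fin d))
  simp only [Prod.fst_zero, inner_zero_right, Prod.snd_zero, add_zero, mul_zero,
    Complex.ofReal_zero, zero_mul, neg_zero, Complex.exp_zero, one_mul] at h
  rw [Measure.integral_comp_smul, h]
  simp [gaussWindow2]

lemma integral_cexp_neg_half_pi (ξ : EuclideanSpace ℝ (Fin d)) :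
    ∫ y : EuclideanSpace ℝ (Fin d),
      Complex.exp (-(π / 2) * ‖y‖ ^ 2 + (-2 * π * Complex.I) * ⟪ξ, y⟫) =
      (2 : ℂ) ^ (d / 2 : ℂ) * (gaussWindow ξ) ^ 2 := by
  have hpi : (π : ℂ) ≠ 0 := by exact_mod_cast Real.pi_ne_zero
  rw [GaussianFourier.integral_cexp_neg_mul_sq_norm_add (b := (π / 2 : ℂ))
    (by simpa using Real.pi_pos) (-2 * π * Complex.I) ξ]
  rw [finrank_euclideanSpace_fin, gaussWindow, Complex.ofReal_exp, ← Complex.exp_nat_mul,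
    show (π : ℂ) / (π / 2) = 2 by field_simp]
  congr 2
  push_cast
  field_simp
  rw [Complex.I_sq]; ring

lemma conj_cexp_mul_gaussWindow (r : ℝ) (t : EuclideanSpace ℝ (Fin d)) :
    (starRingEnd ℂ) (Complex.exp ((r : ℂ) * Complex.I) * gaussWindow t) =
      Complex.exp (-((r : ℂ) * Complex.I)) * gaussWindow t := by
  rw [map_mul, ← Complex.exp_conj, map_mul, Complex.conj_I, Complex.conj_ofReal, gaussWindow,
    Complex.conj_ofReal, mul_neg]

/-- The cross-Wigner distribution of two time-frequency shifted Gaussians is a modulated and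
translated squared Gaussian. -/
lemma wigner_gaussWindow (z w : EuclideanSpace ℝ (Fin d) × EuclideanSpace ℝ (Fin d))
    (x ξ : EuclideanSpace ℝ (Fin d)) :
    ∫ (y : EuclideanSpace ℝ (Fin d)),
        Complex.exp (-(((2 * π * ⟪y, ξ⟫ : ℝ) : ℂ) * Complex.I)) *
          (Complex.exp ((((2 * π * ⟪z.2, x + (1 / 2 : ℝ) • y⟫ : ℝ) : ℂ) * Complex.I)) *
            gaussWindow (x + (1 / 2 : ℝ) • y - z.1)) *
          (starRingEnd ℂ) (Complex.exp ((((2 * π * ⟪w.2, x - (1 / 2 : ℝ) • y⟫ : ℝ) : ℂ) *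
            Complex.I)) * gaussWindow (x - (1 / 2 : ℝ) • y - w.1)) =
      ((2 : ℂ) ^ (d / 2 : ℂ) * Complex.exp
          (((2 * π * ⟪(1 / 2 : ℝ) • (z.2 + w.2), z.1 - w.1⟫ : ℝ) : ℂ) * Complex.I)) *
        (Complex.exp (-(((2 * π * (⟪w.2 - z.2, x⟫ + ⟪z.1 - w.1, ξ⟫) : ℝ) : ℂ) * Complex.I)) *
          gaussWindow2 ((x, ξ) - (1 / 2 : ℝ) • (z + w)) ^ 2) := by
  have hint (y : EuclideanSpace ℝ (Fin d)) :
      Complex.exp (-(((2 * π * ⟪y, ξ⟫ : ℝ) : ℂ) * Complex.I)) *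
          (Complex.exp ((((2 * π * ⟪z.2, x + (1 / 2 : ℝ) • y⟫ : ℝ) : ℂ) * Complex.I)) *
            gaussWindow (x + (1 / 2 : ℝ) • y - z.1)) *
          (starRingEnd ℂ) (Complex.exp ((((2 * π * ⟪w.2, x - (1 / 2 : ℝ) • y⟫ : ℝ) : ℂ) *
            Complex.I)) * gaussWindow (x - (1 / 2 : ℝ) • y - w.1)) =
      (Complex.exp (((2 * π * (⟪z.2 - w.2, x⟫ - ⟪ξ - (1 / 2 : ℝ) • (z.2 + w.2), z.1 - w.1⟫) : ℝ)
          : ℂ) * Complex.I) * gaussWindow (x - (1 / 2 : ℝ) • (z.1 + w.1)) ^ 2) *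
        Complex.exp (-(π / 2) * ‖y - (z.1 - w.1)‖ ^ 2 + (-2 * π * Complex.I) *
          ⟪ξ - (1 / 2 : ℝ) • (z.2 + w.2), y - (z.1 - w.1)⟫) := by
    have hnorm : ‖x + (1 / 2 : ℝ) • y - z.1‖ ^ 2 + ‖x - (1 / 2 : ℝ) • y - w.1‖ ^ 2 =
        2 * ‖x - (1 / 2 : ℝ) • (z.1 + w.1)‖ ^ 2 + 1 / 2 * ‖y - (z.1 - w.1)‖ ^ 2 := by
      have h := parallelogram_law_with_norm ℝ (x - (1 / 2 : ℝ) • (z.1 + w.1))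
        ((1 / 2 : ℝ) • (y - (z.1 - w.1)))
      rw [show x - (1 / 2 : ℝ) • (z.1 + w.1) + (1 / 2 : ℝ) • (y - (z.1 - w.1)) =
          x + (1 / 2 : ℝ) • y - z.1 by module,
        show x - (1 / 2 : ℝ) • (z.1 + w.1) - (1 / 2 : ℝ) • (y - (z.1 - w.1)) =
          x - (1 / 2 : ℝ) • y - w.1 by module, norm_smul, Real.norm_of_nonneg (by norm_num)] at h
      linarith
    have hphase : -⟪y, ξ⟫ + ⟪z.2, x + (1 / 2 : ℝ) • y⟫ - ⟪w.2, x - (1 / 2 : ℝ) • y⟫ =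
        ⟪z.2 - w.2, x⟫ - ⟪ξ - (1 / 2 : ℝ) • (z.2 + w.2), z.1 - w.1⟫ -
          ⟪ξ - (1 / 2 : ℝ) • (z.2 + w.2), y - (z.1 - w.1)⟫ := by
      rw [real_inner_comm]
      simp only [inner_sub_left, inner_sub_right, inner_add_left, inner_add_right,
        real_inner_smul_left, real_inner_smul_right]
      ring
    rw [conj_cexp_mul_gaussWindow]
    simp only [gaussWindow, Complex.ofReal_exp, ← Complex.exp_nat_mul, ← Complex.exp_add]
    congr 1
    have hnormC := congrArg (fun r : ℝ => (r : ℂ)) hnorm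
    have hphaseC := congrArg (fun r : ℝ => (r : ℂ)) hphase
    push_cast at hnormC hphaseC ⊢
    linear_combination (-π : ℂ) * hnormC + (2 * π * Complex.I) * hphaseC
  simp_rw [hint]
  rw [integral_const_mul, integral_sub_right_eq_self (fun y : EuclideanSpace ℝ (Fin d) =>
    Complex.exp (-(π / 2) * ‖y‖ ^ 2 + (-2 * π * Complex.I) *
      ⟪ξ - (1 / 2 : ℝ) • (z.2 + w.2), y⟫)), integral_cexp_neg_half_pi, gaussWindow2_eq_mul]
  have hphase : ⟪z.2 - w.2, x⟫ - ⟪ξ - (1 / 2 : ℝ) • (z.2 + w.2), z.1 - w.1⟫ =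
      ⟪(1 / 2 : ℝ) • (z.2 + w.2), z.1 - w.1⟫ - (⟪w.2 - z.2, x⟫ + ⟪z.1 - w.1, ξ⟫) := by
    rw [real_inner_comm ξ (z.1 - w.1)]
    simp only [inner_sub_left]
    ring
  rw [hphase, mul_sub, Complex.ofReal_sub, sub_mul, sub_eq_add_neg, Complex.exp_add]
  simp only [Prod.fst_sub, Prod.snd_sub, Prod.smul_fst, Prod.smul_snd, Prod.fst_add, Prod.snd_add]
  ring

end Gaussian

section Windows

variable {d : ℕ}

/-- `win u ζ` is the modulated and translated Gaussian `v ↦ e^{-2πiζ·v} G(v-u)`. -/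
abbrev IsGaussianWindowFamily (win : EuclideanSpace ℝ (Fin d) × EuclideanSpace ℝ (Fin d) →
    EuclideanSpace ℝ (Fin d) × EuclideanSpace ℝ (Fin d) →
    SchwartzMap (EuclideanSpace ℝ (Fin d) × EuclideanSpace ℝ (Fin d)) ℂ) : Prop :=
  ∀ u ζ v, win u ζ v =
    Complex.exp (-(((2 * π * (⟪ζ.1, v.1⟫ + ⟪ζ.2, v.2⟫) : ℝ) : ℂ) * Complex.I)) *
      gaussWindow2 (v - u)

/-- The squared Gaussian window `v ↦ e^{-2πiζ·v} G(v-u)²`. -/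
def sqWin (win : EuclideanSpace ℝ (Fin d) × EuclideanSpace ℝ (Fin d) →
      EuclideanSpace ℝ (Fin d) × EuclideanSpace ℝ (Fin d) →
      SchwartzMap (EuclideanSpace ℝ (Fin d) × EuclideanSpace ℝ (Fin d)) ℂ)
    (u ζ : EuclideanSpace ℝ (Fin d) × EuclideanSpace ℝ (Fin d)) :
    SchwartzMap (EuclideanSpace ℝ (Fin d) × EuclideanSpace ℝ (Fin d)) ℂ :=
  SchwartzMap.smulLeftCLM ℂ (win u 0) (win u ζ)

lemma sqNorm2_nonneg (z : EuclideanSpace ℝ (Fin d) × EuclideanSpace ℝ (Fin d)) :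
    0 ≤ sqNorm2 z := by
  unfold sqNorm2; positivity

lemma norm_gaussWindow2_le_one (z : EuclideanSpace ℝ (Fin d) × EuclideanSpace ℝ (Fin d)) :
    ‖gaussWindow2 z‖ ≤ 1 := by
  rw [gaussWindow2, Complex.norm_real, Real.norm_of_nonneg (Real.exp_nonneg _), Real.exp_le_one_iff]
  have := mul_nonneg Real.pi_pos.le (sqNorm2_nonneg z)
  rw [sqNorm2] at this
  linarith

lemma gaussWindow2_neg (z : EuclideanSpace ℝ (Fin d) × EuclideanSpace ℝ (Fin d)) :
    gaussWindow2 (-z) = gaussWindow2 z := by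
  simp [gaussWindow2]

lemma gaussWindow2_sub_two_smul_mul
    (v p : EuclideanSpace ℝ (Fin d) × EuclideanSpace ℝ (Fin d)) :
    gaussWindow2 (v - (2 : ℝ) • p) * gaussWindow2 v =
      gaussWindow2 p ^ 2 * gaussWindow2 (v - p) ^ 2 := by
  have h (a b : EuclideanSpace ℝ (Fin d)) :
      ‖a - (2 : ℝ) • b‖ ^ 2 + ‖a‖ ^ 2 = 2 * ‖b‖ ^ 2 + 2 * ‖a - b‖ ^ 2 := by
    have := parallelogram_law_with_norm ℝ (a - b) b
    rw [show a - b + b = a by module, show a - b - b = a - (2 : ℝ) • b by module] at this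
    linarith
  simp only [gaussWindow2, ← Complex.ofReal_mul, ← Complex.ofReal_pow, ← Real.exp_add,
    ← Real.exp_nat_mul]
  congr 2
  simp only [Prod.fst_sub, Prod.snd_sub, Prod.smul_fst, Prod.smul_snd]
  push_cast
  linear_combination (-π) * (h v.1 p.1) + (-π) * (h v.2 p.2)

/-- Peetre's inequality on phase space. -/
lemma one_add_sqNorm2_le (ζ η : EuclideanSpace ℝ (Fin d) × EuclideanSpace ℝ (Fin d)) :
    1 + sqNorm2 ζ ≤ 2 * (1 + sqNorm2 (ζ + η)) * (1 + sqNorm2 η) := by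
  have h (a b : EuclideanSpace ℝ (Fin d)) : ‖a‖ ^ 2 ≤ 2 * ‖a + b‖ ^ 2 + 2 * ‖b‖ ^ 2 := by
    have := norm_sub_le (a + b) b
    rw [add_sub_cancel_right] at this
    nlinarith [norm_nonneg a, norm_nonneg (a + b), norm_nonneg b, sq_nonneg (‖a + b‖ - ‖b‖)]
  have h0 := mul_nonneg (sqNorm2_nonneg (ζ + η)) (sqNorm2_nonneg η)
  have h1 := h ζ.1 η.1
  have h2 := h ζ.2 η.2
  simp only [sqNorm2, Prod.fst_add, Prod.snd_add] at h0 ⊢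
  nlinarith

lemma one_add_sqNorm2_rpow_le {s : ℝ} (hs : 0 ≤ s)
    (ζ η : EuclideanSpace ℝ (Fin d) × EuclideanSpace ℝ (Fin d)) :
    (1 + sqNorm2 ζ) ^ (s / 2) ≤
      2 ^ (s / 2) * (1 + sqNorm2 (ζ + η)) ^ (s / 2) * (1 + sqNorm2 η) ^ (s / 2) := by
  have h1 := sqNorm2_nonneg ζ
  have h2 := sqNorm2_nonneg (ζ + η)
  have h3 := sqNorm2_nonneg η
  rw [← Real.mul_rpow (by norm_num) (by positivity), ← Real.mul_rpow (by positivity)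
    (by positivity)]
  exact Real.rpow_le_rpow (by positivity) (one_add_sqNorm2_le ζ η) (by positivity)

lemma continuous_sqNorm2 :
    Continuous (sqNorm2 : EuclideanSpace ℝ (Fin d) × EuclideanSpace ℝ (Fin d) → ℝ) := by
  unfold sqNorm2; fun_prop

lemma integrable_one_add_sqNorm2_rpow_mul_norm (s : ℝ)
    (f : SchwartzMap (EuclideanSpace ℝ (Fin d) × EuclideanSpace ℝ (Fin d)) ℂ) :
    Integrable fun η => (1 + sqNorm2 η) ^ (s / 2) * ‖f η‖ := by
  obtain ⟨n, hn⟩ := exists_nat_ge (s / 2)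
  have hint : Integrable fun η => 2 ^ (n - 1) *
      (‖f η‖ + 2 ^ n * (‖η‖ ^ (2 * n) * ‖f η‖)) :=
    (f.integrable.norm.add ((f.integrable_pow_mul volume (2 * n)).const_mul _)).const_mul _
  have hpos (η : EuclideanSpace ℝ (Fin d) × EuclideanSpace ℝ (Fin d)) : 0 < 1 + sqNorm2 η := by
    linarith [sqNorm2_nonneg η]
  refine hint.mono' ?_ (.of_forall fun η => ?_)
  · refine Continuous.aestronglyMeasurable ((Continuous.rpow_const ?_ fun η =>
      Or.inl (hpos η).ne').mul f.continuous.norm)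
    exact continuous_const.add continuous_sqNorm2
  · have h1 : sqNorm2 η ≤ 2 * ‖η‖ ^ 2 := by
      have := pow_le_pow_left₀ (norm_nonneg _) (norm_fst_le η) 2
      have := pow_le_pow_left₀ (norm_nonneg _) (norm_snd_le η) 2
      unfold sqNorm2; linarith
    have h2 : (1 + sqNorm2 η) ^ (s / 2) ≤ 2 ^ (n - 1) * (1 + 2 ^ n * ‖η‖ ^ (2 * n)) := by
      calc (1 + sqNorm2 η) ^ (s / 2) ≤ (1 + sqNorm2 η) ^ (n : ℝ) :=
            Real.rpow_le_rpow_of_exponent_le (by linarith [sqNorm2_nonneg η]) hn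
        _ = (1 + sqNorm2 η) ^ n := Real.rpow_natCast _ _
        _ ≤ (1 + 2 * ‖η‖ ^ 2) ^ n := by gcongr; exact (hpos η).le
        _ ≤ _ := by
          refine (add_pow_le zero_le_one (by positivity) n).trans_eq ?_
          rw [one_pow, mul_pow, pow_mul]
    rw [norm_mul, norm_norm, Real.norm_of_nonneg (Real.rpow_nonneg (hpos η).le _)]
    refine (mul_le_mul_of_nonneg_right h2 (norm_nonneg _)).trans_eq ?_
    ring

variable (σ : SchwartzMap (EuclideanSpace ℝ (Fin d) × EuclideanSpace ℝ (Fin d)) ℂ →L[ℂ] ℂ)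
  {win : EuclideanSpace ℝ (Fin d) × EuclideanSpace ℝ (Fin d) →
    EuclideanSpace ℝ (Fin d) × EuclideanSpace ℝ (Fin d) →
    SchwartzMap (EuclideanSpace ℝ (Fin d) × EuclideanSpace ℝ (Fin d)) ℂ}

lemma win_zero_apply (hwin : IsGaussianWindowFamily win)
    (u v : EuclideanSpace ℝ (Fin d) × EuclideanSpace ℝ (Fin d)) :
    win u 0 v = gaussWindow2 (v - u) := by
  simp [hwin]

lemma sqWin_apply (u ζ v : EuclideanSpace ℝ (Fin d) × EuclideanSpace ℝ (Fin d)) :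
    sqWin win u ζ v = win u 0 v * win u ζ v := by
  rw [sqWin, SchwartzMap.smulLeftCLM_apply_apply (win u 0).hasTemperateGrowth, smul_eq_mul]

/-- The squared window is a Gaussian superposition of modulated windows. -/
lemma map_sqWin_eq_integral (hwin : IsGaussianWindowFamily win)
    (u ζ : EuclideanSpace ℝ (Fin d) × EuclideanSpace ℝ (Fin d)) :
    σ (sqWin win u ζ) = ∫ η : EuclideanSpace ℝ (Fin d) × EuclideanSpace ℝ (Fin d),
      (gaussWindow2 η * Complex.exp (((2 * π * (⟪η.1, u.1⟫ + ⟪η.2, u.2⟫) : ℝ) : ℂ) *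
        Complex.I)) * σ (win u (ζ + η)) := by
  let q : (EuclideanSpace ℝ (Fin d) × EuclideanSpace ℝ (Fin d)) ×
      (EuclideanSpace ℝ (Fin d) × EuclideanSpace ℝ (Fin d)) → ℝ := fun x =>
    -(2 * π * (⟪x.1.1, x.2.1 - u.1⟫ + ⟪x.1.2, x.2.2 - u.2⟫))
  have hq : q.HasTemperateGrowth := by
    have h (L L' : (EuclideanSpace ℝ (Fin d) × EuclideanSpace ℝ (Fin d)) ×
        (EuclideanSpace ℝ (Fin d) × EuclideanSpace ℝ (Fin d)) →L[ℝ] EuclideanSpace ℝ (Fin d))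
        (c : EuclideanSpace ℝ (Fin d)) :
        (fun x => ⟪L x, L' x - c⟫).HasTemperateGrowth :=
      (innerSL ℝ).bilinear_hasTemperateGrowth L.hasTemperateGrowth
        (L'.hasTemperateGrowth.sub (.const c))
    have h1 := h (.fst ℝ _ _ ∘L .fst ℝ _ _) (.fst ℝ _ _ ∘L .snd ℝ _ _) u.1
    have h2 := h (.snd ℝ _ _ ∘L .fst ℝ _ _) (.snd ℝ _ _ ∘L .snd ℝ _ _) u.2
    exact ((Function.HasTemperateGrowth.const (2 * π)).mul (h1.add h2)).neg
  let Φ := SchwartzMap.smulLeftCLM ℂ (fun x => Complex.exp (q x * Complex.I))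
    (schwartzTensor (win 0 0) (win u ζ))
  have hΦ (x) : Φ x = Complex.exp (q x * Complex.I) * (gaussWindow2 x.1 * win u ζ x.2) := by
    rw [SchwartzMap.smulLeftCLM_apply_apply hq.cexp_mul_I, schwartzTensor_apply,
      win_zero_apply hwin, sub_zero, smul_eq_mul]
  rw [map_integral_slice volume σ Φ (fun η => (gaussWindow2 η *
    Complex.exp (((2 * π * (⟪η.1, u.1⟫ + ⟪η.2, u.2⟫) : ℝ) : ℂ) * Complex.I)) •
      win u (ζ + η)) ?_ (sqWin win u ζ) ?_]
  · simp only [map_smul, smul_eq_mul]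
  · intro η v
    rw [hΦ, smul_apply, smul_eq_mul, hwin, hwin]
    simp only [gaussWindow2, Complex.ofReal_exp, ← Complex.exp_add, q]
    congr 1
    simp only [Prod.fst_add, Prod.snd_add, inner_add_left, inner_sub_right]
    push_cast
    ring
  · intro v
    rw [sqWin_apply, win_zero_apply hwin, ← integral_cexp_mul_gaussWindow2 (v - u),
      ← integral_mul_const]
    congr 1
    ext η
    rw [hΦ]
    simp only [q, Prod.fst_sub, Prod.snd_sub, Complex.ofReal_neg, neg_mul, mul_assoc]

lemma map_win_eq_integral (hwin : IsGaussianWindowFamily win)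
    (u ζ : EuclideanSpace ℝ (Fin d) × EuclideanSpace ℝ (Fin d)) :
    (∫ p : EuclideanSpace ℝ (Fin d) × EuclideanSpace ℝ (Fin d), gaussWindow2 ((2 : ℝ) • p)) *
        σ (win u ζ) =
      ∫ p : EuclideanSpace ℝ (Fin d) × EuclideanSpace ℝ (Fin d),
        gaussWindow2 p ^ 2 * σ (sqWin win (u + p) ζ) := by
  let L : (EuclideanSpace ℝ (Fin d) × EuclideanSpace ℝ (Fin d)) ×
      (EuclideanSpace ℝ (Fin d) × EuclideanSpace ℝ (Fin d)) →L[ℝ]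
      (EuclideanSpace ℝ (Fin d) × EuclideanSpace ℝ (Fin d)) ×
      (EuclideanSpace ℝ (Fin d) × EuclideanSpace ℝ (Fin d)) :=
    ContinuousLinearMap.prod (.snd ℝ _ _ - (2 : ℝ) • .fst ℝ _ _) (.snd ℝ _ _)
  have hL (x) : L x = (x.2 - (2 : ℝ) • x.1, x.2) := rfl
  have hbound (x) : ‖x‖ ≤ 1 * (1 + ‖L x‖) ^ 1 := by
    have h1 : ‖x.2‖ ≤ ‖L x‖ := norm_snd_le (L x)
    have h2 : ‖x.2 - (2 : ℝ) • x.1‖ ≤ ‖L x‖ := norm_fst_le (L x)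
    have h3 := norm_sub_le x.2 (x.2 - (2 : ℝ) • x.1)
    rw [sub_sub_cancel, norm_smul, Real.norm_of_nonneg zero_le_two] at h3
    rw [Prod.norm_def, max_le_iff]
    constructor <;> linarith [norm_nonneg (L x)]
  let Φ := SchwartzMap.compCLM ℂ L.hasTemperateGrowth ⟨1, 1, hbound⟩
    (schwartzTensor (win u 0) (win u ζ))
  have hΦ (x) : Φ x = gaussWindow2 (x.2 - (2 : ℝ) • x.1 - u) * win u ζ x.2 := by
    rw [SchwartzMap.compCLM_apply, Function.comp_apply, schwartzTensor_apply, hL,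
      win_zero_apply hwin]
  rw [← smul_eq_mul, ← map_smul]
  rw [map_integral_slice volume σ Φ (fun p => gaussWindow2 p ^ 2 • sqWin win (u + p) ζ) ?_ _ ?_]
  · simp only [map_smul, smul_eq_mul]
  · intro p v
    have h := gaussWindow2_sub_two_smul_mul (v - u) p
    rw [sub_sub v u p, sub_right_comm] at h
    rw [hΦ, smul_apply, smul_eq_mul, sqWin_apply, win_zero_apply hwin, hwin, hwin]
    linear_combination (-Complex.exp (-(((2 * π * (⟪ζ.1, v.1⟫ + ⟪ζ.2, v.2⟫) : ℝ) : ℂ) *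
      Complex.I))) * h
  · intro v
    rw [smul_apply, smul_eq_mul]
    simp_rw [hΦ]
    rw [integral_mul_const]
    congr 1
    rw [← integral_sub_right_eq_self _ ((1 / 2 : ℝ) • (v - u))]
    congr 1
    ext p
    rw [← gaussWindow2_neg]
    congr 1
    module

lemma exists_norm_map_sqWin_le (hwin : IsGaussianWindowFamily win) {s : ℝ} (hs : 0 ≤ s) {C : ℝ}
    (h : ∀ u ζ, (1 + sqNorm2 ζ) ^ (s / 2) * ‖σ (win u ζ)‖ ≤ C) :
    ∃ C', ∀ u ζ, (1 + sqNorm2 ζ) ^ (s / 2) * ‖σ (sqWin win u ζ)‖ ≤ C' := by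
  refine ⟨∫ η, 2 ^ (s / 2) * C * ((1 + sqNorm2 η) ^ (s / 2) * ‖win 0 0 η‖), fun u ζ => ?_⟩
  have hpos (η : EuclideanSpace ℝ (Fin d) × EuclideanSpace ℝ (Fin d)) : 0 < 1 + sqNorm2 η := by
    linarith [sqNorm2_nonneg η]
  have hnn := (Real.rpow_nonneg (hpos ζ).le (s / 2))
  rw [map_sqWin_eq_integral σ hwin, ← Real.norm_of_nonneg hnn, ← norm_smul, ← integral_smul]
  refine norm_integral_le_of_norm_le
    ((integrable_one_add_sqNorm2_rpow_mul_norm s (win 0 0)).const_mul _) (.of_forall fun η => ?_)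
  rw [norm_smul, norm_mul, norm_mul, Complex.norm_exp_ofReal_mul_I, mul_one,
    Real.norm_of_nonneg hnn, win_zero_apply hwin, sub_zero]
  calc _ ≤ (2 ^ (s / 2) * (1 + sqNorm2 (ζ + η)) ^ (s / 2) * (1 + sqNorm2 η) ^ (s / 2)) *
        (‖gaussWindow2 η‖ * ‖σ (win u (ζ + η))‖) := by
        gcongr; exact one_add_sqNorm2_rpow_le hs ζ η
    _ = (2 ^ (s / 2) * ((1 + sqNorm2 η) ^ (s / 2) * ‖gaussWindow2 η‖)) *
        ((1 + sqNorm2 (ζ + η)) ^ (s / 2) * ‖σ (win u (ζ + η))‖) := by ring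
    _ ≤ (2 ^ (s / 2) * ((1 + sqNorm2 η) ^ (s / 2) * ‖gaussWindow2 η‖)) * C := by
        have := Real.rpow_nonneg (hpos η).le (s / 2)
        gcongr; exact h u (ζ + η)
    _ = _ := by ring

lemma exists_norm_map_win_le (hwin : IsGaussianWindowFamily win) {s C : ℝ}
    (h : ∀ u ζ, (1 + sqNorm2 ζ) ^ (s / 2) * ‖σ (sqWin win u ζ)‖ ≤ C) :
    ∃ C', ∀ u ζ, (1 + sqNorm2 ζ) ^ (s / 2) * ‖σ (win u ζ)‖ ≤ C' := by
  set K := ∫ p : EuclideanSpace ℝ (Fin d) × EuclideanSpace ℝ (Fin d), gaussWindow2 ((2 : ℝ) • p)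
  have hK0 : 0 < ‖K‖ := norm_pos_iff.2 integral_gaussWindow2_two_smul_ne_zero
  refine ⟨(∫ p, ‖win 0 0 p‖ * C) / ‖K‖, fun u ζ => ?_⟩
  have hpos : 0 < 1 + sqNorm2 ζ := by linarith [sqNorm2_nonneg ζ]
  have hnn := (Real.rpow_nonneg hpos.le (s / 2))
  rw [le_div_iff₀ hK0, mul_assoc, mul_comm ‖σ _‖, ← norm_mul, map_win_eq_integral σ hwin,
    ← Real.norm_of_nonneg hnn, ← norm_smul, ← integral_smul]
  refine norm_integral_le_of_norm_le ((win 0 0).integrable.norm.mul_const C)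
    (.of_forall fun p => ?_)
  rw [norm_smul, norm_mul, norm_pow, Real.norm_of_nonneg hnn, win_zero_apply hwin, sub_zero]
  calc _ = ‖gaussWindow2 p‖ ^ 2 * ((1 + sqNorm2 ζ) ^ (s / 2) * ‖σ (sqWin win (u + p) ζ)‖) := by
        ring
    _ ≤ ‖gaussWindow2 p‖ * C := by
        refine mul_le_mul ?_ (h (u + p) ζ) (by positivity) (norm_nonneg _)
        exact pow_le_of_le_one (norm_nonneg _) (norm_gaussWindow2_le_one p) two_ne_zero

/-- The cross-Wigner distribution of two time-frequency shifted Gaussians is a multiple of a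
squared window. -/
lemma norm_map_wigner (hwin : IsGaussianWindowFamily win)
    {tf : EuclideanSpace ℝ (Fin d) × EuclideanSpace ℝ (Fin d) →
      SchwartzMap (EuclideanSpace ℝ (Fin d)) ℂ}
    (htf : ∀ z t, tf z t =
      Complex.exp ((((2 * π * ⟪z.2, t⟫ : ℝ) : ℂ) * Complex.I)) * gaussWindow (t - z.1))
    {Wig : SchwartzMap (EuclideanSpace ℝ (Fin d)) ℂ →
      SchwartzMap (EuclideanSpace ℝ (Fin d)) ℂ →
      SchwartzMap (EuclideanSpace ℝ (Fin d) × EuclideanSpace ℝ (Fin d)) ℂ}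
    (hWig : ∀ f₁ f₂ x ξ, Wig f₁ f₂ (x, ξ) =
      ∫ (y : EuclideanSpace ℝ (Fin d)),
        Complex.exp (-(((2 * π * ⟪y, ξ⟫ : ℝ) : ℂ) * Complex.I)) *
          f₁ (x + (1 / 2 : ℝ) • y) * (starRingEnd ℂ) (f₂ (x - (1 / 2 : ℝ) • y)))
    (z w : EuclideanSpace ℝ (Fin d) × EuclideanSpace ℝ (Fin d)) :
    ‖σ (Wig (tf z) (tf w))‖ = ‖(2 : ℂ) ^ (d / 2 : ℂ)‖ *
      ‖σ (sqWin win ((1 / 2 : ℝ) • (z + w)) (w.2 - z.2, z.1 - w.1))‖ := by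
  have h : Wig (tf z) (tf w) = ((2 : ℂ) ^ (d / 2 : ℂ) * Complex.exp
      (((2 * π * ⟪(1 / 2 : ℝ) • (z.2 + w.2), z.1 - w.1⟫ : ℝ) : ℂ) * Complex.I)) •
        sqWin win ((1 / 2 : ℝ) • (z + w)) (w.2 - z.2, z.1 - w.1) := by
    ext ⟨x, ξ⟩
    rw [hWig]
    simp_rw [htf]
    rw [wigner_gaussWindow, smul_apply, smul_eq_mul, sqWin_apply,
      win_zero_apply hwin, hwin]
    ring
  rw [h, map_smul, norm_smul, norm_mul, Complex.norm_exp_ofReal_mul_I, mul_one]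

lemma sqNorm2_symplectic (z w : EuclideanSpace ℝ (Fin d) × EuclideanSpace ℝ (Fin d)) :
    sqNorm2 (w.2 - z.2, z.1 - w.1) = sqNorm2 (w - z) := by
  simp only [sqNorm2, Prod.fst_sub, Prod.snd_sub]
  rw [norm_sub_rev z.1 w.1, add_comm]

end Windows

/-- **Almost diagonalization of Weyl operators with `M^∞_s` symbols by Gaussian
time-frequency shifts** (Gröchenig–Rzeszotnik): a tempered distribution `σ` on `ℝ^{2d}`
belongs to `M^∞_s(ℝ^{2d})` (i.e. `sup ⟨ζ⟩^s |V_G σ(u,ζ)| < ∞`) if and only if the Gabor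
matrix `M(z,w) = |σ(W(π(z)g, π(w)g))| = |⟨σ^w π(z)g, π(w)g⟩|` of its Weyl operator
satisfies `M(z,w) ≤ C ⟨w-z⟩^{-s}`. Here `tf z` packages the time-frequency shift
`π(z)g`, `Wig f₁ f₂` the cross-Wigner distribution `W(f₁,f₂)`, and `win u ζ` the window
`v ↦ e^{-2πiζ·v} G(v-u)` defining `V_G σ(u,ζ) = σ(win u ζ)`. -/
theorem weyl_almost_diagonalization_polynomial
    {d : ℕ} (hd : 1 ≤ d) (s : ℝ) (hs : 0 ≤ s)
    (σ : SchwartzMap (EuclideanSpace ℝ (Fin d) × EuclideanSpace ℝ (Fin d)) ℂ →L[ℂ] ℂ)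
    (tf : EuclideanSpace ℝ (Fin d) × EuclideanSpace ℝ (Fin d) →
      SchwartzMap (EuclideanSpace ℝ (Fin d)) ℂ)
    (htf : ∀ z t, tf z t =
      Complex.exp ((((2 * π * ⟪z.2, t⟫ : ℝ) : ℂ) * Complex.I)) * gaussWindow (t - z.1))
    (Wig : SchwartzMap (EuclideanSpace ℝ (Fin d)) ℂ →
      SchwartzMap (EuclideanSpace ℝ (Fin d)) ℂ →
      SchwartzMap (EuclideanSpace ℝ (Fin d) × EuclideanSpace ℝ (Fin d)) ℂ)
    (hWig : ∀ f₁ f₂ x ξ, Wig f₁ f₂ (x, ξ) =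
      ∫ (y : EuclideanSpace ℝ (Fin d)),
        Complex.exp (-(((2 * π * ⟪y, ξ⟫ : ℝ) : ℂ) * Complex.I)) *
          f₁ (x + (1 / 2 : ℝ) • y) * (starRingEnd ℂ) (f₂ (x - (1 / 2 : ℝ) • y)))
    (win : EuclideanSpace ℝ (Fin d) × EuclideanSpace ℝ (Fin d) →
      EuclideanSpace ℝ (Fin d) × EuclideanSpace ℝ (Fin d) →
      SchwartzMap (EuclideanSpace ℝ (Fin d) × EuclideanSpace ℝ (Fin d)) ℂ)
    (hwin : ∀ u ζ v, win u ζ v =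
      Complex.exp (-(((2 * π * (⟪ζ.1, v.1⟫ + ⟪ζ.2, v.2⟫) : ℝ) : ℂ) * Complex.I)) *
        gaussWindow2 (v - u)) :
    (∃ C : ℝ, ∀ u ζ : EuclideanSpace ℝ (Fin d) × EuclideanSpace ℝ (Fin d),
        (1 + sqNorm2 ζ) ^ (s / 2) * ‖σ (win u ζ)‖ ≤ C) ↔
      (∃ C : ℝ, 0 < C ∧ ∀ z w : EuclideanSpace ℝ (Fin d) × EuclideanSpace ℝ (Fin d),
        ‖σ (Wig (tf z) (tf w))‖ ≤ C * (1 + sqNorm2 (w - z)) ^ (-s / 2)) := by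
  have hK : 0 < ‖(2 : ℂ) ^ (d / 2 : ℂ)‖ := by
    rw [norm_pos_iff, Complex.cpow_ne_zero_iff]
    exact Or.inl two_ne_zero
  have hpos (η : EuclideanSpace ℝ (Fin d) × EuclideanSpace ℝ (Fin d)) :
      0 < (1 + sqNorm2 η) ^ (s / 2) :=
    Real.rpow_pos_of_pos (by linarith [sqNorm2_nonneg η]) _
  have hneg (η : EuclideanSpace ℝ (Fin d) × EuclideanSpace ℝ (Fin d)) :
      (1 + sqNorm2 η) ^ (-s / 2) = ((1 + sqNorm2 η) ^ (s / 2))⁻¹ := by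
    rw [neg_div, Real.rpow_neg (by linarith [sqNorm2_nonneg η])]
  constructor
  · rintro ⟨C₀, hC₀⟩
    obtain ⟨C, hC⟩ := exists_norm_map_sqWin_le σ hwin hs hC₀
    refine ⟨‖(2 : ℂ) ^ (d / 2 : ℂ)‖ * max C 1, by positivity, fun z w => ?_⟩
    rw [norm_map_wigner σ hwin htf hWig, mul_assoc]
    gcongr
    rw [hneg, ← div_eq_mul_inv, le_div_iff₀ (hpos _), mul_comm, ← sqNorm2_symplectic]
    exact (hC _ _).trans (le_max_left _ _)
  · rintro ⟨C, -, hC⟩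
    refine exists_norm_map_win_le σ hwin (C := C / ‖(2 : ℂ) ^ (d / 2 : ℂ)‖) fun u ζ => ?_
    have h := hC (u - (1 / 2 : ℝ) • (-ζ.2, ζ.1)) (u + (1 / 2 : ℝ) • (-ζ.2, ζ.1))
    have hu : (1 / 2 : ℝ) • (u - (1 / 2 : ℝ) • (-ζ.2, ζ.1) + (u + (1 / 2 : ℝ) • (-ζ.2, ζ.1))) =
        u := by module
    have hζ : ((u + (1 / 2 : ℝ) • (-ζ.2, ζ.1)).2 - (u - (1 / 2 : ℝ) • (-ζ.2, ζ.1)).2,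
        (u - (1 / 2 : ℝ) • (-ζ.2, ζ.1)).1 - (u + (1 / 2 : ℝ) • (-ζ.2, ζ.1)).1) = ζ := by
      ext1 <;> simp only [Prod.fst_sub, Prod.snd_sub, Prod.fst_add, Prod.snd_add, Prod.smul_fst,
        Prod.smul_snd] <;> module
    rw [norm_map_wigner σ hwin htf hWig, ← sqNorm2_symplectic, hneg, hu, hζ, ← div_eq_mul_inv,
      le_div_iff₀ (hpos _)] at h
    rw [le_div_iff₀ hK]
    linarith
end
end
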